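/- arXiv:1608.04588 — 2 statements merged into one kernel-verified Lean document; each statement's English description precedes it below -/
import Mathlib

section
/- Let R be a Gorenstein local ring and let M and N be nonzero finitely generated R-modules. If Êxt^i_R(M,N) = 0 for all i ≤ depth_R(N), then sup{ i : Ext^i_R(N,M) ≠ 0 } = depth R − depth_R(N). -/
open CategoryTheory CategoryTheory.Limits CategoryTheory.MonoidalCategory Opposite

noncomputable section

universe u

variable (R : Type u) [CommRing R]

/-- Ordinary `Ext` of `R`-modules, via the derived functor `Ext` of Mathlib. -/
abbrev ExtMod (n : ℕ) (M N : ModuleCat.{u} R) : ModuleCat.{u} R :=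
  ((Ext R (ModuleCat.{u} R) n).obj (op M)).obj N

/-- Ordinary `Tor` of `R`-modules, via the derived functor `Tor` of Mathlib. -/
abbrev TorMod (n : ℕ) (M N : ModuleCat.{u} R) : ModuleCat.{u} R :=
  ((Tor (ModuleCat.{u} R) n).obj M).obj N

/-- A finitely generated module `M` is totally reflexive (of G-dimension zero) if the
biduality map is an isomorphism and `Ext^i(M,R) = 0 = Ext^i(M^*,R)` for all `i > 0`. -/
def IsTotallyReflexive (M : ModuleCat.{u} R) : Prop :=
  Module.Finite R M ∧
  Function.Bijective (Module.Dual.eval R M) ∧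
  (∀ i : ℕ, 0 < i → IsZero (ExtMod R i M (ModuleCat.of R R))) ∧
  (∀ i : ℕ, 0 < i → IsZero (ExtMod R i (ModuleCat.of R (Module.Dual R M)) (ModuleCat.of R R)))

/-- `M` admits a resolution `0 → G_n → ⋯ → G_0 → M → 0` by totally reflexive modules. -/
def GDimLE (M : ModuleCat.{u} R) (n : ℕ) : Prop :=
  ∃ (G : ChainComplex (ModuleCat.{u} R) ℕ) (ε : G.X 0 ⟶ M),
    (∀ i, i ≤ n → IsTotallyReflexive R (G.X i)) ∧
    (∀ i, n < i → IsZero (G.X i)) ∧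
    Epi ε ∧
    (∃ w : G.d 1 0 ≫ ε = 0, (ShortComplex.mk (G.d 1 0) ε w).Exact) ∧
    (∀ i, 0 < i → G.ExactAt i)

/-- `M` has finite Gorenstein dimension. -/
def HasFiniteGDim (M : ModuleCat.{u} R) : Prop := ∃ n, GDimLE R M n

/-- The Gorenstein dimension of `M`, as an element of `ℕ∞`. -/
def gdim (M : ModuleCat.{u} R) : ℕ∞ :=
  sInf {c : ℕ∞ | ∃ n : ℕ, c = n ∧ GDimLE R M n}

/-- `M` admits a projective resolution of length at most `n`. -/
def PdLE (M : ModuleCat.{u} R) (n : ℕ) : Prop :=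
  ∃ (G : ChainComplex (ModuleCat.{u} R) ℕ) (ε : G.X 0 ⟶ M),
    (∀ i, Projective (G.X i)) ∧
    (∀ i, n < i → IsZero (G.X i)) ∧
    Epi ε ∧
    (∃ w : G.d 1 0 ≫ ε = 0, (ShortComplex.mk (G.d 1 0) ε w).Exact) ∧
    (∀ i, 0 < i → G.ExactAt i)

/-- `M` has finite projective dimension. -/
def HasFinitePd (M : ModuleCat.{u} R) : Prop := ∃ n, PdLE R M n

/-- The projective dimension of `M`, as an element of `ℕ∞`. -/
def pdim (M : ModuleCat.{u} R) : ℕ∞ :=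
  sInf {c : ℕ∞ | ∃ n : ℕ, c = n ∧ PdLE R M n}

/-- `M` admits an injective resolution `0 → M → I^0 → ⋯ → I^n → 0`. -/
def InjDimLE (M : ModuleCat.{u} R) (n : ℕ) : Prop :=
  ∃ (I : CochainComplex (ModuleCat.{u} R) ℕ) (ι : M ⟶ I.X 0),
    (∀ i, Injective (I.X i)) ∧
    (∀ i, n < i → IsZero (I.X i)) ∧
    Mono ι ∧
    (∃ w : ι ≫ I.d 0 1 = 0, (ShortComplex.mk ι (I.d 0 1) w).Exact) ∧
    (∀ i, 0 < i → I.ExactAt i)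

/-- `M` has finite injective dimension. -/
def HasFiniteInjDim (M : ModuleCat.{u} R) : Prop := ∃ n, InjDimLE R M n

/-- A Gorenstein local ring: a commutative Noetherian local ring of finite self-injective
dimension. -/
def IsGorensteinLocalRing : Prop :=
  IsLocalRing R ∧ IsNoetherianRing R ∧ HasFiniteInjDim R (ModuleCat.of R R)

/-- The grade of a module: `grade M = inf { i | Ext^i(M,R) ≠ 0 }`. -/
def gradeM (M : ModuleCat.{u} R) : ℕ∞ :=
  sInf {c : ℕ∞ | ∃ i : ℕ, c = i ∧ ¬ IsZero (ExtMod R i M (ModuleCat.of R R))}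

/-- A module is G-perfect if its grade equals its Gorenstein dimension. -/
def IsGPerfect (M : ModuleCat.{u} R) : Prop := gradeM R M = gdim R M

/-- An ideal `c` is perfect if `grade (R/c) = pd (R/c)`. -/
def IsPerfectIdeal (c : Ideal R) : Prop :=
  gradeM R (ModuleCat.of R (R ⧸ c)) = pdim R (ModuleCat.of R (R ⧸ c))

/-- A complete resolution `T → P → M` of `M`: `P → M` is a resolution by finite projective
modules, `T` is a totally acyclic complex of finite projective modules, and `θ i` is an
isomorphism for all `i ≫ 0`. -/
structure CompleteResolution (M : ModuleCat.{u} R) where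
  T : ChainComplex (ModuleCat.{u} R) ℤ
  P : ChainComplex (ModuleCat.{u} R) ℤ
  θ : T ⟶ P
  π : P.X 0 ⟶ M
  projT : ∀ i, Projective (T.X i)
  fgT : ∀ i, Module.Finite R (T.X i)
  projP : ∀ i, Projective (P.X i)
  fgP : ∀ i, Module.Finite R (P.X i)
  zeroP : ∀ i : ℤ, i < 0 → IsZero (P.X i)
  epiπ : Epi π
  wπ : P.d 1 0 ≫ π = 0
  exact0 : (ShortComplex.mk (P.d 1 0) π wπ).Exact
  exactP : ∀ i : ℤ, 0 < i → P.ExactAt i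
  exactT : ∀ i : ℤ, T.ExactAt i
  exactTdual : ∀ i : ℤ, (T.linearYonedaObj R (ModuleCat.of R R)).ExactAt i
  iso_eventually : ∃ n₀ : ℤ, ∀ i : ℤ, n₀ ≤ i → IsIso (θ.f i)

/-- Tate cohomology `Êxt^i(M,N) = H^i(Hom(T,N))` computed from a complete resolution of `M`. -/
def TateExt {M : ModuleCat.{u} R} (C : CompleteResolution R M) (N : ModuleCat.{u} R)
    (i : ℤ) : ModuleCat.{u} R :=
  (C.T.linearYonedaObj R N).homology i

/-- Tate homology `T̂or_i(M,N) = H_i(T ⊗ N)` computed from a complete resolution of `M`. -/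
def TateTor {M : ModuleCat.{u} R} (C : CompleteResolution R M) (N : ModuleCat.{u} R)
    (i : ℤ) : ModuleCat.{u} R :=
  ((((tensoringRight (ModuleCat.{u} R)).obj N).mapHomologicalComplex _).obj C.T).homology i

/-- The depth of a module over a local ring: the supremum of the lengths of the
`M`-regular sequences contained in the maximal ideal. -/
def moduleDepth [IsLocalRing R] (M : Type u) [AddCommGroup M] [Module R M] : ℕ∞ :=
  sSup {c : ℕ∞ | ∃ rs : List R, c = rs.length ∧
    (∀ r ∈ rs, r ∈ IsLocalRing.maximalIdeal R) ∧ RingTheory.Sequence.IsRegular M rs}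

/-- `E` is an injective envelope of the residue field `k`: an injective module which is an
essential extension of `k`. -/
def IsInjectiveEnvelopeOfResidueField [IsLocalRing R] (E : Type u) [AddCommGroup E]
    [Module R E] : Prop :=
  Injective (ModuleCat.of R E) ∧
  ∃ ι : IsLocalRing.ResidueField R →ₗ[R] E,
    Function.Injective ι ∧
    ∀ N : Submodule R E, N ≠ ⊥ → N ⊓ LinearMap.range ι ≠ ⊥


/-- A minimal free resolution `⋯ → F_1 → F_0 → M → 0` of a finitely generated module over a
local ring, recorded by its Betti numbers `b n` and differentials with image inside
`m • F_n`. -/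
structure MinFreeRes [IsLocalRing R] (M : Type u) [AddCommGroup M] [Module R M] where
  b : ℕ → ℕ
  d : ∀ n : ℕ, ((Fin (b (n+1)) → R) →ₗ[R] (Fin (b n) → R))
  aug : (Fin (b 0) → R) →ₗ[R] M
  aug_surj : Function.Surjective aug
  exact_zero : LinearMap.ker aug = LinearMap.range (d 0)
  exact_succ : ∀ n, LinearMap.ker (d n) = LinearMap.range (d (n+1))
  minimal : ∀ n, LinearMap.range (d n) ≤ (IsLocalRing.maximalIdeal R) • ⊤

/-- The Betti numbers of `M` are eventually bounded by `γ · n^(c-1)`. -/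
def CxLE [IsLocalRing R] (M : Type u) [AddCommGroup M] [Module R M] (c : ℕ) : Prop :=
  ∃ (F : MinFreeRes R M) (γ : ℝ) (n₀ : ℕ),
    ∀ n : ℕ, n₀ ≤ n → (F.b n : ℝ) ≤ γ * (n : ℝ) ^ ((c : ℤ) - 1)

/-- The complexity of a module: the least `c` such that the Betti numbers are eventually
bounded by `γ · n^(c-1)` for some `γ`. -/
def complexity [IsLocalRing R] (M : Type u) [AddCommGroup M] [Module R M] : ℕ∞ :=
  sInf {e : ℕ∞ | ∃ c : ℕ, e = c ∧ CxLE R M c}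

/-- The pushout `K_η` of a map `f : Ω^{j+1} M → M` (representing a degree-`(j+1)`
homogeneous element `η` of `Ext^*(M,M)`) along the inclusion `Ω^{j+1} M ↪ F_j`: the
cokernel of `(f, -incl) : Ω^{j+1} M → M ⊕ F_j`. -/
abbrev PushoutMod [IsLocalRing R] {M : Type u} [AddCommGroup M] [Module R M]
    (F : MinFreeRes R M) (j : ℕ) (f : LinearMap.range (F.d j) →ₗ[R] M) : Type u :=
  (M × (Fin (F.b j) → R)) ⧸
    LinearMap.range (LinearMap.prod f (-(LinearMap.range (F.d j)).subtype))

/-- Auxiliary predicate: `M` has reducible complexity, with recursion depth `≤ c`. -/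
def RedCxAux [IsLocalRing R] :
    ℕ → ∀ (M : Type u) (_ : AddCommGroup M) (_ : Module R M), Prop
  | 0, M, g, m =>
      letI := g; letI := m
      HasFinitePd R (ModuleCat.of R M)
  | (c+1), M, g, m =>
      letI := g; letI := m
      HasFinitePd R (ModuleCat.of R M) ∨
      (complexity R M < ⊤ ∧ 0 < complexity R M ∧
        ∃ (j : ℕ) (F : MinFreeRes R M) (f : LinearMap.range (F.d j) →ₗ[R] M),
          complexity R (PushoutMod R F j f) < complexity R M ∧
          moduleDepth R (PushoutMod R F j f) = moduleDepth R M ∧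
          RedCxAux c (PushoutMod R F j f) inferInstance inferInstance)

/-- `M` has reducible complexity. -/
def HasReducibleComplexity [IsLocalRing R] (M : Type u) [AddCommGroup M] [Module R M] :
    Prop :=
  ∃ c : ℕ, RedCxAux R c M inferInstance inferInstance

/-- `L` is (isomorphic to) `λ N = Ω Tr N`, computed from a minimal free presentation of `N`
over the local ring `S`. -/
def IsLambdaOf (S : Type u) [CommRing S] [IsLocalRing S]
    (N L : Type u) [AddCommGroup N] [Module S N] [AddCommGroup L] [Module S L] : Prop :=
  ∃ (n₀ n₁ : ℕ) (g : (Fin n₀ → S) →ₗ[S] N) (f : (Fin n₁ → S) →ₗ[S] (Fin n₀ → S)),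
    Function.Surjective g ∧
    LinearMap.range f = LinearMap.ker g ∧
    LinearMap.ker g ≤ (IsLocalRing.maximalIdeal S) • ⊤ ∧
    LinearMap.ker f ≤ (IsLocalRing.maximalIdeal S) • ⊤ ∧
    Nonempty (L ≃ₗ[S] LinearMap.range f.dualMap)

/-- `M` and `N` are linked by the ideal `c`: both are annihilated by `c` (hence are
`R/c`-modules) and `M ≅ λ_{R/c} N`, `N ≅ λ_{R/c} M`. -/
def LinkedBy (c : Ideal R) (M N : Type u) [AddCommGroup M] [Module (R ⧸ c) M]
    [AddCommGroup N] [Module (R ⧸ c) N] [IsLocalRing (R ⧸ c)] : Prop :=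
  IsLambdaOf (R ⧸ c) N M ∧ IsLambdaOf (R ⧸ c) M N

set_option linter.unusedSectionVars false

namespace S11
section ev
variable {R : Type} [CommRing R]

/-- Vanishing of `Ext^n(X,Y)`. -/
def EV (R : Type) [CommRing R] (X Y : Type) [AddCommGroup X] [Module R X] [AddCommGroup Y]
    [Module R Y] (n : ℕ) : Prop :=
  Subsingleton (Abelian.Ext (ModuleCat.of R X) (ModuleCat.of R Y) n)

variable {X Y Z D : Type} [AddCommGroup X] [Module R X] [AddCommGroup Y] [Module R Y]
  [AddCommGroup Z] [Module R Z] [AddCommGroup D] [Module R D]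

/-- the short complex attached to an exact pair of linear maps -/
def sc (f : X →ₗ[R] Y) (g : Y →ₗ[R] Z) (h : Function.Exact f g) :
    ShortComplex (ModuleCat.{0} R) :=
  ModuleCat.shortComplexOfCompEqZero f g h.linearMap_comp_eq_zero

theorem sc_se {f : X →ₗ[R] Y} {g : Y →ₗ[R] Z} (hf : Function.Injective f)
    (hg : Function.Surjective g) (h : Function.Exact f g) : (sc f g h).ShortExact :=
  ModuleCat.shortComplex_shortExact _ h hf hg

theorem EV.mk (n : ℕ) (h : ∀ e : Abelian.Ext (ModuleCat.of R X) (ModuleCat.of R Y) n, e = 0) :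
    EV R X Y n := ⟨fun a b => by rw [h a, h b]⟩

theorem EV.eq0 {n : ℕ} (h : EV R X Y n)
    (e : Abelian.Ext (ModuleCat.of R X) (ModuleCat.of R Y) n) : e = 0 := by
  have : Subsingleton _ := h
  exact Subsingleton.elim _ _

variable {f : X →ₗ[R] Y} {g : Y →ₗ[R] Z}

theorem contra3 (hf : Function.Injective f) (hg : Function.Surjective g)
    (h : Function.Exact f g) {n : ℕ} (h1 : EV R X D n) (h2 : EV R Y D (n+1)) :
    EV R Z D (n+1) := by
  apply EV.mk
  intro e
  obtain ⟨x, hx⟩ := Abelian.Ext.contravariant_sequence_exact₃ (sc_se hf hg h) (ModuleCat.of R D) e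
    (h2.eq0 _) (add_comm 1 n)
  have : x = 0 := h1.eq0 x
  rw [← hx, this, Abelian.Ext.comp_zero]; rfl

theorem contra1 (hf : Function.Injective f) (hg : Function.Surjective g)
    (h : Function.Exact f g) {n : ℕ} (h1 : EV R Y D n) (h2 : EV R Z D (n+1)) :
    EV R X D n := by
  apply EV.mk
  intro e
  obtain ⟨x, hx⟩ := Abelian.Ext.contravariant_sequence_exact₁ (sc_se hf hg h) (ModuleCat.of R D) e
    (add_comm 1 n) (h2.eq0 _)
  have : x = 0 := h1.eq0 x
  rw [← hx, this, Abelian.Ext.comp_zero]; rfl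

theorem contra2 (hf : Function.Injective f) (hg : Function.Surjective g)
    (h : Function.Exact f g) {n : ℕ} (h1 : EV R X D n) (h2 : EV R Z D n) :
    EV R Y D n := by
  apply EV.mk
  intro e
  obtain ⟨x, hx⟩ := Abelian.Ext.contravariant_sequence_exact₂ (sc_se hf hg h) (ModuleCat.of R D) e
    (h1.eq0 _)
  have : x = 0 := h2.eq0 x
  rw [← hx, this, Abelian.Ext.comp_zero]; rfl

theorem contraExtend (hf : Function.Injective f) (hg : Function.Surjective g)
    (h : Function.Exact f g) (h1 : EV R Z D 1) (u : X →ₗ[R] D) :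
    ∃ v : Y →ₗ[R] D, v ∘ₗ f = u := by
  obtain ⟨x, hx⟩ := Abelian.Ext.contravariant_sequence_exact₁ (sc_se hf hg h) (ModuleCat.of R D)
    (Abelian.Ext.mk₀ (ModuleCat.ofHom u)) (add_comm 1 0) (h1.eq0 _)
  obtain ⟨w, rfl⟩ := Abelian.Ext.homEquiv₀.symm.surjective x
  refine ⟨ModuleCat.Hom.hom w, ?_⟩
  simp only [Abelian.Ext.homEquiv₀_symm_apply, Abelian.Ext.mk₀_comp_mk₀] at hx
  have := Abelian.Ext.homEquiv₀.symm.injective hx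
  have := congrArg ModuleCat.Hom.hom this
  exact this

theorem co3 (hf : Function.Injective f) (hg : Function.Surjective g)
    (h : Function.Exact f g) {n : ℕ} (h1 : EV R D Y n) (h2 : EV R D X (n+1)) :
    EV R D Z n := by
  apply EV.mk
  intro e
  obtain ⟨x, hx⟩ := Abelian.Ext.covariant_sequence_exact₃ (ModuleCat.of R D) (sc_se hf hg h) e
    rfl (h2.eq0 _)
  have : x = 0 := h1.eq0 x
  rw [← hx, this, Abelian.Ext.zero_comp]; rfl

theorem co1 (hf : Function.Injective f) (hg : Function.Surjective g)
    (h : Function.Exact f g) {n : ℕ} (h1 : EV R D Z n) (h2 : EV R D Y (n+1)) :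
    EV R D X (n+1) := by
  apply EV.mk
  intro e
  obtain ⟨x, hx⟩ := Abelian.Ext.covariant_sequence_exact₁ (ModuleCat.of R D) (sc_se hf hg h) e
    (h2.eq0 _) rfl
  have : x = 0 := h1.eq0 x
  rw [← hx, this, Abelian.Ext.zero_comp]; rfl

theorem co2 (hf : Function.Injective f) (hg : Function.Surjective g)
    (h : Function.Exact f g) {n : ℕ} (h1 : EV R D X n) (h2 : EV R D Z n) :
    EV R D Y n := by
  apply EV.mk
  intro e
  obtain ⟨x, hx⟩ := Abelian.Ext.covariant_sequence_exact₂ (ModuleCat.of R D) (sc_se hf hg h) e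
    (h2.eq0 _)
  have : x = 0 := h1.eq0 x
  rw [← hx, this, Abelian.Ext.zero_comp]; rfl

theorem coSurj (hf : Function.Injective f) (hg : Function.Surjective g)
    (h : Function.Exact f g) (h1 : ∀ u : D →ₗ[R] Z, ∃ v : D →ₗ[R] Y, g ∘ₗ v = u)
    (h2 : EV R D Y 1) : EV R D X 1 := by
  apply EV.mk
  intro e
  obtain ⟨x, hx⟩ := Abelian.Ext.covariant_sequence_exact₁ (ModuleCat.of R D) (sc_se hf hg h) e
    (h2.eq0 _) rfl
  obtain ⟨w, rfl⟩ := Abelian.Ext.homEquiv₀.symm.surjective x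
  obtain ⟨v, hv⟩ := h1 (ModuleCat.Hom.hom w)
  obtain ⟨v', this⟩ : ∃ v' : ModuleCat.of R D ⟶ (sc f g h).X₂, w = v' ≫ (sc f g h).g :=
    ⟨ModuleCat.ofHom v, by ext x; exact (LinearMap.congr_fun hv x).symm⟩
  rw [← hx, this]
  simp only [Abelian.Ext.homEquiv₀_symm_apply]
  rw [← Abelian.Ext.mk₀_comp_mk₀, Abelian.Ext.comp_assoc_of_second_deg_zero,
    ShortComplex.ShortExact.comp_extClass, Abelian.Ext.comp_zero]
  rfl

theorem contraEx1 (hf : Function.Injective f) (hg : Function.Surjective g)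
    (h : Function.Exact f g) {n : ℕ} (h1 : EV R Z D (n+1))
    (e : Abelian.Ext (ModuleCat.of R X) (ModuleCat.of R D) n) :
    ∃ x : Abelian.Ext (ModuleCat.of R Y) (ModuleCat.of R D) n,
      (Abelian.Ext.mk₀ (ModuleCat.ofHom f)).comp x (zero_add n) = e :=
  Abelian.Ext.contravariant_sequence_exact₁ (sc_se hf hg h) (ModuleCat.of R D) e
    (add_comm 1 n) (h1.eq0 _)

theorem coEx3 (hf : Function.Injective f) (hg : Function.Surjective g)
    (h : Function.Exact f g) {n : ℕ} (h1 : EV R D X (n+1))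
    (e : Abelian.Ext (ModuleCat.of R D) (ModuleCat.of R Z) n) :
    ∃ x : Abelian.Ext (ModuleCat.of R D) (ModuleCat.of R Y) n,
      x.comp (Abelian.Ext.mk₀ (ModuleCat.ofHom g)) (add_zero n) = e :=
  Abelian.Ext.covariant_sequence_exact₃ (ModuleCat.of R D) (sc_se hf hg h) e
    rfl (h1.eq0 _)

theorem coEx2 (hf : Function.Injective f) (hg : Function.Surjective g)
    (h : Function.Exact f g) {n : ℕ} (h1 : EV R D Z n)
    (e : Abelian.Ext (ModuleCat.of R D) (ModuleCat.of R Y) n) :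
    ∃ x : Abelian.Ext (ModuleCat.of R D) (ModuleCat.of R X) n,
      x.comp (Abelian.Ext.mk₀ (ModuleCat.ofHom f)) (add_zero n) = e :=
  Abelian.Ext.covariant_sequence_exact₂ (ModuleCat.of R D) (sc_se hf hg h) e (h1.eq0 _)

theorem ev_equiv_left (e : X ≃ₗ[R] Y) {n : ℕ} (h : EV R X D n) : EV R Y D n := by
  apply EV.mk
  intro a
  have : a = (Abelian.Ext.mk₀ (ModuleCat.ofHom e.symm.toLinearMap)).comp
      ((Abelian.Ext.mk₀ (ModuleCat.ofHom e.toLinearMap)).comp a (zero_add n)) (zero_add n) := by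
    have h0 : ModuleCat.ofHom e.symm.toLinearMap ≫ ModuleCat.ofHom e.toLinearMap =
      𝟙 (ModuleCat.of R Y) := by ext; simp
    rw [Abelian.Ext.mk₀_comp_mk₀_assoc, h0, Abelian.Ext.mk₀_id_comp]
  rw [this, h.eq0 (Abelian.Ext.comp _ a _), Abelian.Ext.comp_zero]

theorem ev_equiv_right (e : X ≃ₗ[R] Y) {n : ℕ} (h : EV R D X n) : EV R D Y n := by
  apply EV.mk
  intro a
  have : a = (a.comp (Abelian.Ext.mk₀ (ModuleCat.ofHom e.symm.toLinearMap)) (add_zero n)).comp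
      (Abelian.Ext.mk₀ (ModuleCat.ofHom e.toLinearMap)) (add_zero n) := by
    have h0 : ModuleCat.ofHom e.symm.toLinearMap ≫ ModuleCat.ofHom e.toLinearMap =
      𝟙 (ModuleCat.of R Y) := by ext; simp
    rw [Abelian.Ext.comp_assoc_of_second_deg_zero, Abelian.Ext.mk₀_comp_mk₀, h0,
      Abelian.Ext.comp_mk₀_id]
  rw [this, h.eq0 (Abelian.Ext.comp a _ _), Abelian.Ext.zero_comp]

theorem ev_proj [Module.Projective R X] (n : ℕ) : EV R X D (n+1) := by
  have : Projective (ModuleCat.of R X) := by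
    rw [← IsProjective.iff_projective]; infer_instance
  exact Abelian.Ext.subsingleton_of_projective _ _ n

theorem ev_zero_left [Subsingleton X] (n : ℕ) : EV R X D n := by
  apply EV.mk
  intro a
  have h0 : 𝟙 (ModuleCat.of R X) = 0 := by ext x; exact Subsingleton.elim (α := X) _ _
  rw [← Abelian.Ext.mk₀_id_comp a, h0, Abelian.Ext.mk₀_zero, Abelian.Ext.zero_comp]

theorem ev_zero_right [Subsingleton X] (n : ℕ) : EV R D X n := by
  apply EV.mk
  intro a
  have h0 : 𝟙 (ModuleCat.of R X) = 0 := by ext x; exact Subsingleton.elim (α := X) _ _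
  rw [← Abelian.Ext.comp_mk₀_id a, h0, Abelian.Ext.mk₀_zero, Abelian.Ext.comp_zero]

theorem exact_inl_snd : Function.Exact (LinearMap.inl R X Y) (LinearMap.snd R X Y) :=
  Function.Exact.inl_snd

theorem ev_pi_right {n : ℕ} (h : EV R D X n) : ∀ b : ℕ, EV R D (Fin b → X) n
  | 0 => ev_zero_right n
  | b+1 => ev_equiv_right (Fin.consLinearEquiv R (fun _ : Fin (b+1) => X))
      (co2 LinearMap.inl_injective LinearMap.snd_surjective exact_inl_snd h (ev_pi_right h b))

theorem ev_pi_left {n : ℕ} (h : EV R X D n) : ∀ b : ℕ, EV R (Fin b → X) D n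
  | 0 => ev_zero_left n
  | b+1 => ev_equiv_left (Fin.consLinearEquiv R (fun _ : Fin (b+1) => X))
      (contra2 LinearMap.inl_injective LinearMap.snd_surjective exact_inl_snd h (ev_pi_left h b))

theorem ev_zero_iff : EV R X Y 0 ↔ Subsingleton (X →ₗ[R] Y) := by
  unfold EV
  rw [Abelian.Ext.addEquiv₀.subsingleton_congr]
  exact ModuleCat.homAddEquiv.subsingleton_congr

end ev
end S11

namespace S11
section extmod
variable {R : Type} [CommRing R]

theorem yo_exact_iff {α : Type} [AddRightCancelSemigroup α] [One α]
    (T : ChainComplex (ModuleCat.{0} R) α) (A : ModuleCat.{0} R) (h i j : α)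
    (hh : (ComplexShape.up α).prev i = h) (hj : (ComplexShape.up α).next i = j) :
    (T.linearYonedaObj R A).ExactAt i ↔
      ∀ f : T.X i ⟶ A, T.d j i ≫ f = 0 → ∃ g : T.X h ⟶ A, T.d i h ≫ g = f := by
  rw [HomologicalComplex.exactAt_iff' _ h i j hh hj, ShortComplex.moduleCat_exact_iff]
  exact Iff.rfl

theorem isZero_extMod_iff (X Y : Type) [AddCommGroup X] [Module R X] [AddCommGroup Y] [Module R Y]
    (i : ℕ) : IsZero (ExtMod R i (ModuleCat.of R X) (ModuleCat.of R Y)) ↔ EV R X Y i := by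
  let P : ProjectiveResolution (ModuleCat.of R X) := projectiveResolution _
  have h1 : IsZero (ExtMod R i (ModuleCat.of R X) (ModuleCat.of R Y)) ↔
      (P.complex.linearYonedaObj R (ModuleCat.of R Y)).ExactAt i := by
    rw [HomologicalComplex.exactAt_iff_isZero_homology]
    exact (P.isoExt i (ModuleCat.of R Y)).isZero_iff
  rw [h1]
  cases i with
  | zero =>
    rw [yo_exact_iff P.complex (ModuleCat.of R Y) 0 0 1 (by simp) (by simp), ev_zero_iff]
    obtain ⟨p, hp, w, hex⟩ : ∃ p : P.complex.X 0 ⟶ ModuleCat.of R X, Epi p ∧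
        ∃ w : P.complex.d 1 0 ≫ p = 0, (ShortComplex.mk _ p w).Exact :=
      ⟨P.π.f 0, inferInstanceAs (Epi (P.π.f 0)), P.complex_d_comp_π_f_zero, P.exact₀⟩
    constructor
    · intro h
      refine ⟨fun a b => ?_⟩
      have key : ∀ a : X →ₗ[R] Y, a = 0 := by
        intro a
        obtain ⟨g, hg⟩ := h (p ≫ ModuleCat.ofHom a) (by
          rw [← Category.assoc, w, zero_comp])
        have h2 : P.complex.d 0 0 = 0 := P.complex.shape _ _ (by simp)
        rw [h2, zero_comp] at hg
        have h3 : ModuleCat.ofHom a = 0 := by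
          rw [← cancel_epi p, ← hg, comp_zero]
        exact congrArg ModuleCat.Hom.hom h3
      rw [key a, key b]
    · intro h f hf
      refine ⟨0, ?_⟩
      have h3 := hex.desc' (k := f) hf
      obtain ⟨l, hl⟩ := h3
      have hl0 : l = 0 := by
        apply ModuleCat.hom_ext
        exact h.elim _ _
      rw [← hl, hl0, comp_zero, comp_zero]
  | succ n =>
    rw [yo_exact_iff P.complex (ModuleCat.of R Y) n (n+1) (n+2) (by simp) (by simp)]
    constructor
    · intro h
      apply EV.mk
      intro e
      obtain ⟨f, hf, rfl⟩ := P.extMk_surjective e (n+2) rfl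
      rw [P.extMk_eq_zero_iff _ _ _ _ n rfl]
      exact h f hf
    · intro h f hf
      rw [← P.extMk_eq_zero_iff f (n+2) rfl hf n rfl]
      exact h.eq0 _

theorem exactAt_fun {ι : Type} {c : ComplexShape ι} (T : HomologicalComplex (ModuleCat.{0} R) c)
    (i j k : ι) (hi : c.prev j = i) (hk : c.next j = k) :
    T.ExactAt j ↔ Function.Exact (T.d i j).hom (T.d j k).hom := by
  rw [HomologicalComplex.exactAt_iff' _ i j k hi hk]
  exact ShortComplex.ShortExact.moduleCat_exact_iff_function_exact _

variable {A B C : Type} [AddCommGroup A] [Module R A] [AddCommGroup B] [Module R B]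
  [AddCommGroup C] [Module R C]

/-- The map `A → ker g` for an exact pair `A → B → C`. -/
def kmap (f : A →ₗ[R] B) (g : B →ₗ[R] C) (h : Function.Exact f g) : A →ₗ[R] LinearMap.ker g :=
  f.codRestrict _ (fun a => h.apply_apply_eq_zero a)

theorem kmap_surj (f : A →ₗ[R] B) (g : B →ₗ[R] C) (h : Function.Exact f g) :
    Function.Surjective (kmap f g h) := by
  rintro ⟨b, hb⟩
  obtain ⟨a, ha⟩ := (h b).1 hb
  exact ⟨a, Subtype.ext ha⟩

theorem kmap_exact (f : A →ₗ[R] B) (g : B →ₗ[R] C) (h : Function.Exact f g) :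
    Function.Exact (LinearMap.ker f).subtype (kmap f g h) := by
  intro a
  exact ⟨fun h => ⟨⟨a, congrArg Subtype.val h⟩, rfl⟩, by
    rintro ⟨⟨b, hb⟩, rfl⟩; exact Subtype.ext hb⟩

theorem ker_exact (f : A →ₗ[R] B) :
    Function.Exact (LinearMap.ker f).subtype f := by
  intro a
  simp

theorem ev_inj [h : Injective (ModuleCat.of R A)] (n : ℕ) : EV R B A (n+1) :=
  Abelian.Ext.subsingleton_of_injective _ _ n

/-- Finite injective dimension in terms of vanishing of Ext. -/
theorem inj_bound (h : HasFiniteInjDim R (ModuleCat.of R R)) :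
    ∃ n : ℕ, ∀ (X : Type) [AddCommGroup X] [Module R X] (i : ℕ), n ≤ i → EV R X R i := by
  obtain ⟨n, I, ι, hI, hz, hm, ⟨w, hw⟩, hex⟩ := h
  have key : ∀ k j : ℕ, j + k = n + 1 → ∀ (X : Type) [AddCommGroup X] [Module R X] (i : ℕ),
      k + 1 ≤ i → EV R X (LinearMap.ker (I.d j (j+1)).hom) i := by
    intro k
    induction k with
    | zero =>
      intro j hj X _ _ i hi
      have : Subsingleton (I.X j) := ModuleCat.subsingleton_of_isZero (hz j (by omega))
      exact ev_zero_right _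
    | succ k ih =>
      intro j hj X _ _ i hi
      obtain ⟨i, rfl⟩ : ∃ i', i = i' + 1 := ⟨i-1, by omega⟩
      have h1 := ih (j+1) (by omega) X i (by omega)
      have hx := (exactAt_fun I j (j+1) (j+2) (by simp) (by simp)).1 (hex (j+1) (by omega))
      have : Injective (ModuleCat.of R (I.X j)) := hI j
      exact co1 (Submodule.subtype_injective _) (kmap_surj _ _ hx) (kmap_exact _ _ hx) h1 (ev_inj _)
  refine ⟨n+2, fun X _ _ i hi => ?_⟩
  have h0 := key (n+1) 0 (by omega) X i (by omega)
  have hw' : Function.Exact ι.hom (I.d 0 1).hom :=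
    (ShortComplex.ShortExact.moduleCat_exact_iff_function_exact _).1 hw
  have hinj : Function.Injective ι.hom := (ModuleCat.mono_iff_injective _).1 hm
  have e : R ≃ₗ[R] LinearMap.ker (I.d 0 1).hom :=
    LinearEquiv.ofBijective (kmap ι.hom _ hw') ⟨fun a b hab => hinj (congrArg Subtype.val hab),
      kmap_surj _ _ _⟩
  exact ev_equiv_right e.symm h0
end extmod
end S11

namespace S11
section depth
open RingTheory.Sequence
open scoped Pointwise
variable {R : Type} [CommRing R] [IsLocalRing R] [IsNoetherianRing R]

theorem nak0 {E : Type*} [AddCommGroup E] [Module R E] [Module.Finite R E]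
    (h : ∀ e : E, e ∈ (IsLocalRing.maximalIdeal R • ⊤ : Submodule R E)) : Subsingleton E := by
  have h1 : (⊤ : Submodule R E) = ⊥ :=
    Submodule.eq_bot_of_le_smul_of_le_jacobson_bot (IsLocalRing.maximalIdeal R) ⊤
      Module.Finite.fg_top (fun e _ => h e)
      (by rw [IsLocalRing.jacobson_eq_maximalIdeal _ bot_ne_top])
  exact ⟨fun a b => by
    have ha : a ∈ (⊤ : Submodule R E) := trivial
    have hb : b ∈ (⊤ : Submodule R E) := trivial
    rw [h1, Submodule.mem_bot] at ha hb
    rw [ha, hb]⟩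

variable {N : Type} [AddCommGroup N] [Module R N]
variable {Y : Type} [AddCommGroup Y] [Module R Y]

theorem smul_inj {x : R} (hx : IsSMulRegular N x) :
    Function.Injective (LinearMap.lsmul R N x) := fun _ _ h => hx h

theorem smul_ex (x : R) :
    Function.Exact (LinearMap.lsmul R N x) (Submodule.mkQ (x • (⊤ : Submodule R N))) := by
  intro a
  simp [Submodule.mem_smul_pointwise_iff_exists]

theorem ev_nak [Module.Finite R N] [Module.Finite R Y] {x : R}
    (hm : x ∈ IsLocalRing.maximalIdeal R) (hx : IsSMulRegular N x) {i : ℕ}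
    (h : EV R (QuotSMulTop x N) Y (i+1)) : EV R N Y i := by
  have : Module.Finite R (Abelian.Ext (ModuleCat.of R N) (ModuleCat.of R Y) i) := inferInstance
  refine nak0 (R := R) ?_
  intro e
  obtain ⟨x2, hx2⟩ := contraEx1 (smul_inj hx) (Submodule.mkQ_surjective _) (smul_ex x) h e
  have h3 : e = x • x2 := by
    rw [← hx2]
    have h4 : ModuleCat.ofHom (LinearMap.lsmul R N x) = x • 𝟙 (ModuleCat.of R N) := rfl
    rw [h4, Abelian.Ext.mk₀_smul, Abelian.Ext.smul_comp, Abelian.Ext.mk₀_id_comp]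
  rw [h3]
  exact Submodule.smul_mem_smul hm trivial

/-- `a` is the top nonvanishing degree of `Ext(N,R)`. -/
def S (R : Type) [CommRing R] (N : Type) [AddCommGroup N] [Module R N] (a : ℕ) : Prop :=
  ¬ EV R N R a ∧ ∀ i, a < i → EV R N R i

theorem S_up [Module.Finite R N] {x : R} (hm : x ∈ IsLocalRing.maximalIdeal R)
    (hx : IsSMulRegular N x) {a : ℕ} (h : S R N a) : S R (QuotSMulTop x N) (a+1) := by
  refine ⟨fun h1 => h.1 (ev_nak hm hx h1), fun i hi => ?_⟩
  obtain ⟨i, rfl⟩ : ∃ i', i = i' + 1 := ⟨i-1, by omega⟩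
  exact contra3 (smul_inj hx) (Submodule.mkQ_surjective _) (smul_ex x) (h.2 _ (by omega))
    (h.2 _ (by omega))

theorem S_down [Module.Finite R N] {x : R} (hm : x ∈ IsLocalRing.maximalIdeal R)
    (hx : IsSMulRegular N x) {a : ℕ} (h : S R (QuotSMulTop x N) a) :
    ∃ b, a = b + 1 ∧ S R N b := by
  have h1 : ∀ i, a ≤ i → EV R N R i := fun i hi => ev_nak hm hx (h.2 (i+1) (by omega))
  cases a with
  | zero =>
    exfalso
    apply h.1
    have := ev_zero_iff.1 (h1 0 le_rfl)
    rw [ev_zero_iff]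
    refine ⟨fun f g => ?_⟩
    apply Submodule.linearMap_qext
    exact Subsingleton.elim _ _
  | succ b =>
    refine ⟨b, rfl, fun h2 => h.1 ?_, fun i hi => h1 i hi⟩
    exact contra3 (smul_inj hx) (Submodule.mkQ_surjective _) (smul_ex x) h2 (h1 _ le_rfl)

/-- `t` is the (injective) dimension of the Gorenstein ring. -/
structure IsTop (R : Type) [CommRing R] [IsLocalRing R] (t : ℕ) : Prop where
  van : ∀ (X : Type) [AddCommGroup X] [Module R X] [Module.Finite R X] (i : ℕ), t < i → EV R X R i
  non : ¬ EV R (R ⧸ IsLocalRing.maximalIdeal R) R t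

theorem S_ring : S R R 0 := by
  refine ⟨fun h => ?_, fun i hi => ?_⟩
  · have := ev_zero_iff.1 h
    have h1 : (LinearMap.id : R →ₗ[R] R) = 0 := Subsingleton.elim _ _
    have := LinearMap.congr_fun h1 1
    simp at this
  · obtain ⟨i, rfl⟩ : ∃ i', i = i' + 1 := ⟨i-1, by omega⟩
    exact ev_proj i

theorem exists_top (h : HasFiniteInjDim R (ModuleCat.of R R)) : ∃ t, IsTop R t := by
  classical
  obtain ⟨n0, hn0⟩ := inj_bound h
  let p : ℕ → Prop := fun n => ∀ (X : Type) [AddCommGroup X] [Module R X] [Module.Finite R X]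
    (i : ℕ), n ≤ i → EV R X R i
  have hp : ∃ n, p n := ⟨n0, fun X _ _ _ i hi => hn0 X i hi⟩
  obtain ⟨n, hn, hmin⟩ : ∃ n, p n ∧ ∀ m, m < n → ¬ p m :=
    ⟨Nat.find hp, Nat.find_spec hp, fun m hm => Nat.find_min hp hm⟩
  cases n with
  | zero => exact absurd (hn R 0 le_rfl) S_ring.1
  | succ t =>
    refine ⟨t, fun X _ _ _ i hi => hn X i hi, fun hk => hmin t (by omega) ?_⟩
    intro X _ _ hX i hi
    rcases Nat.lt_or_ge t i with h1 | h1
    · exact hn X i h1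
    obtain rfl : i = t := by omega
    refine IsNoetherianRing.induction_on_isQuotientEquivQuotientPrime R hX
      (motive := fun N _ _ _ => EV R N R i) ?_ ?_ ?_
    · intro N _ _ _ _
      exact ev_zero_left _
    · intro N _ _ _ q e
      apply ev_equiv_left e.symm
      by_cases hq : q.asIdeal = IsLocalRing.maximalIdeal R
      · rw [hq]; exact hk
      · have : ∃ x ∈ IsLocalRing.maximalIdeal R, x ∉ q.asIdeal := by
          by_contra hcon
          push Not at hcon
          exact hq (le_antisymm (IsLocalRing.le_maximalIdeal q.2.ne_top) hcon)
        obtain ⟨x, hx, hxq⟩ := this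
        have hreg : IsSMulRegular (R ⧸ q.asIdeal) x := by
          rw [isSMulRegular_iff_right_eq_zero_of_smul]
          intro y hy
          obtain ⟨y, rfl⟩ := Ideal.Quotient.mk_surjective y
          have : Ideal.Quotient.mk q.asIdeal (x * y) = 0 := hy
          rw [Ideal.Quotient.eq_zero_iff_mem] at this ⊢
          exact (q.2.mem_or_mem this).resolve_left hxq
        exact ev_nak hx hreg (hn _ _ le_rfl)
    · intro N1 _ _ _ N2 _ _ _ N3 _ _ _ f g hf hg hfg h1 h3
      exact contra2 hf hg hfg h1 h3

theorem S_depth_zero {t : ℕ} (ht : IsTop R t) [Module.Finite R N]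
    (h : ∀ x ∈ IsLocalRing.maximalIdeal R, ¬ IsSMulRegular N x) : S R N t := by
  refine ⟨fun h1 => ?_, fun i hi => ht.van N i hi⟩
  have h2 : ¬ Subsingleton ((R ⧸ IsLocalRing.maximalIdeal R) →ₗ[R] N) := by
    rw [IsSMulRegular.subsingleton_linearMap_iff]
    rintro ⟨r, hr, hreg⟩
    rw [Ideal.annihilator_quotient] at hr
    exact h r hr hreg
  rw [not_subsingleton_iff_nontrivial] at h2
  obtain ⟨f, hf⟩ := exists_ne (0 : (R ⧸ IsLocalRing.maximalIdeal R) →ₗ[R] N)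
  have hinj : Function.Injective f := by
    have : IsSimpleModule R (R ⧸ IsLocalRing.maximalIdeal R) :=
      isSimpleModule_iff_isCoatom.2 (IsLocalRing.maximalIdeal.isMaximal R).out
    exact (LinearMap.injective_or_eq_zero f).resolve_right hf
  exact ht.non (contra1 hinj (Submodule.mkQ_surjective (LinearMap.range f))
    (LinearMap.exact_map_mkQ_range f) h1 (ht.van _ _ (by omega)))

theorem S_of_depth {t : ℕ} (ht : IsTop R t) : ∀ (n : ℕ) (N : Type) [AddCommGroup N] [Module R N]
    [Module.Finite R N] [Nontrivial N],
    (∃ rs : List R, rs.length = n ∧ (∀ r ∈ rs, r ∈ IsLocalRing.maximalIdeal R) ∧ IsRegular N rs) →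
    (¬ ∃ rs : List R, rs.length = n + 1 ∧ (∀ r ∈ rs, r ∈ IsLocalRing.maximalIdeal R) ∧
      IsRegular N rs) → n ≤ t ∧ S R N (t - n) := by
  intro n
  induction n with
  | zero =>
    intro N _ _ _ _ _ h2
    refine ⟨by omega, S_depth_zero ht fun x hx hreg => h2 ⟨[x], rfl, by simpa using hx, ?_⟩⟩
    rw [isRegular_cons_iff]
    have := nontrivial_quotSMulTop_of_mem_maximalIdeal N hx
    exact ⟨hreg, IsRegular.nil _ _⟩
  | succ n ih =>
    rintro N _ _ _ _ ⟨rs, hl, hm, hr⟩ h2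
    match rs, hl, hm, hr with
    | x :: rs, hl, hm, hr =>
      rw [isRegular_cons_iff] at hr
      have hx : x ∈ IsLocalRing.maximalIdeal R := hm x (by simp)
      have := nontrivial_quotSMulTop_of_mem_maximalIdeal N hx
      obtain ⟨h3, h4⟩ := ih (QuotSMulTop x N) ⟨rs, by simpa using hl,
        fun r hr => hm r (by simp [hr]), hr.2⟩ (by
          rintro ⟨rs', hl', hm', hr'⟩
          refine h2 ⟨x :: rs', by simp [hl'], ?_, by rw [isRegular_cons_iff]; exact ⟨hr.1, hr'⟩⟩
          intro r hr
          rcases List.mem_cons.1 hr with rfl | hr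
          · exact hx
          · exact hm' r hr)
      obtain ⟨b, hb, hS⟩ := S_down hx hr.1 h4
      refine ⟨by omega, ?_⟩
      have : t - (n+1) = b := by omega
      rwa [this]

theorem length_le {t : ℕ} (ht : IsTop R t) : ∀ (rs : List R) (N : Type) [AddCommGroup N]
    [Module R N] [Module.Finite R N] (a : ℕ), (∀ r ∈ rs, r ∈ IsLocalRing.maximalIdeal R) →
    IsRegular N rs → S R N a → a + rs.length ≤ t
  | [], N, _, _, _, a, _, _, hS => by
    by_contra hcon
    exact hS.1 (ht.van N a (by simpa using hcon))
  | x :: rs, N, _, _, _, a, hm, hr, hS => by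
    rw [isRegular_cons_iff] at hr
    have := length_le ht rs (QuotSMulTop x N) (a+1) (fun r hr => hm r (by simp [hr])) hr.2
      (S_up (hm x (by simp)) hr.1 hS)
    simp only [List.length_cons]
    omega

theorem depth_attained [Module.Finite R N] [Nontrivial N] {n : ℕ}
    (h : moduleDepth R N = (n : ℕ∞)) :
    (∃ rs : List R, rs.length = n ∧ (∀ r ∈ rs, r ∈ IsLocalRing.maximalIdeal R) ∧ IsRegular N rs) ∧
    (¬ ∃ rs : List R, rs.length = n + 1 ∧ (∀ r ∈ rs, r ∈ IsLocalRing.maximalIdeal R) ∧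
      IsRegular N rs) := by
  have hle : ∀ rs : List R, (∀ r ∈ rs, r ∈ IsLocalRing.maximalIdeal R) → IsRegular N rs →
      rs.length ≤ n := by
    intro rs h1 h2
    have : (rs.length : ℕ∞) ≤ moduleDepth R N := le_sSup ⟨rs, rfl, h1, h2⟩
    rw [h] at this
    exact_mod_cast this
  constructor
  · by_contra hcon
    cases n with
    | zero => exact hcon ⟨[], rfl, by simp, IsRegular.nil _ _⟩
    | succ n =>
      have : moduleDepth R N ≤ (n : ℕ∞) := by
        apply sSup_le
        rintro _ ⟨rs, rfl, h1, h2⟩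
        have h3 := hle rs h1 h2
        have h4 : rs.length ≠ n + 1 := fun h4 => hcon ⟨rs, h4, h1, h2⟩
        exact_mod_cast (by omega : rs.length ≤ n)
      rw [h] at this
      have : n + 1 ≤ n := by exact_mod_cast this
      omega
  · rintro ⟨rs, h0, h1, h2⟩
    have := hle rs h1 h2
    omega

theorem depth_ring {t : ℕ} (ht : IsTop R t) : moduleDepth R R = (t : ℕ∞) := by
  have hle : moduleDepth R R ≤ (t : ℕ∞) := by
    apply sSup_le
    rintro _ ⟨rs, rfl, h1, h2⟩
    have := length_le ht rs R 0 h1 h2 S_ring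
    exact_mod_cast (by omega : rs.length ≤ t)
  obtain ⟨l, hl⟩ := ENat.ne_top_iff_exists.1 (ne_top_of_le_ne_top (ENat.natCast_ne_top t) hle)
  obtain ⟨h1, h2⟩ := depth_attained hl.symm
  obtain ⟨h3, h4⟩ := S_of_depth ht l R h1 h2
  have : t - l = 0 := by
    by_contra hcon
    exact h4.1 (S_ring.2 _ (by omega))
  rw [← hl, show l = t by omega]

theorem S_main {t : ℕ} (ht : IsTop R t) [Module.Finite R N] [Nontrivial N] {e : ℕ}
    (he : moduleDepth R N = (e : ℕ∞)) : e ≤ t ∧ S R N (t - e) := by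
  obtain ⟨h1, h2⟩ := depth_attained he
  exact S_of_depth ht e N h1 h2

end depth
end S11

namespace S11
section lemD
variable {R : Type} [CommRing R] [IsLocalRing R] [IsNoetherianRing R]

/-- `U → V` can be continued to the right by `m` exact steps with modules acyclic for `Hom(-,R)`. -/
def Good (R : Type) [CommRing R] : ℕ → ∀ (U V : ModuleCat.{0} R), (U →ₗ[R] V) → Prop
  | 0, _, _, _ => True
  | m+1, _, V, f => ∃ (W : ModuleCat.{0} R) (g : V →ₗ[R] W), Function.Exact f g ∧
      Module.Finite R W ∧ (∀ j, EV R W R (j+1)) ∧ Good R m V W g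

variable {U V W : Type} [AddCommGroup U] [Module R U] [AddCommGroup V] [Module R V]
  [AddCommGroup W] [Module R W]

theorem liftQ_inj (f : U →ₗ[R] V) (g : V →ₗ[R] W) (h : Function.Exact f g) :
    Function.Injective ((LinearMap.range f).liftQ g (h.linearMap_ker_eq ▸ le_rfl)) := by
  rw [← LinearMap.ker_eq_bot]
  exact Submodule.ker_liftQ_eq_bot _ _ _ (h.linearMap_ker_eq ▸ le_rfl)

theorem liftQ_ex (f : U →ₗ[R] V) (g : V →ₗ[R] W) (h : Function.Exact f g) :
    Function.Exact ((LinearMap.range f).liftQ g (h.linearMap_ker_eq ▸ le_rfl))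
      (LinearMap.range g).mkQ := by
  rw [LinearMap.exact_iff, Submodule.ker_mkQ, Submodule.range_liftQ]

theorem good_ev {t : ℕ} (ht : IsTop R t) : ∀ (m : ℕ) (U V : ModuleCat.{0} R) (f : U →ₗ[R] V),
    Module.Finite R V → Good R m U V f → ∀ j, t < j + 1 + m →
    EV R (V ⧸ LinearMap.range f) R (j+1)
  | 0, U, V, f, _, _, j, hj => ht.van _ _ hj
  | m+1, U, V, f, _, ⟨W, g, h, hW, hE, hG⟩, j, hj =>
    contra1 (liftQ_inj f g h) (Submodule.mkQ_surjective _) (liftQ_ex f g h) (hE j)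
      (good_ev ht m V W g hW hG (j+1) (by omega))

theorem good_extend {t : ℕ} (ht : IsTop R t) [Module.Finite R W] (f : U →ₗ[R] V) (g : V →ₗ[R] W)
    (h : Function.Exact f g) (hG : Good R t (ModuleCat.of R V) (ModuleCat.of R W) g)
    (u : V →ₗ[R] R) (hu : u ∘ₗ f = 0) : ∃ v : W →ₗ[R] R, v ∘ₗ g = u := by
  have h1 : EV R (W ⧸ LinearMap.range g) R 1 :=
    good_ev ht t (ModuleCat.of R V) (ModuleCat.of R W) g inferInstance hG 0 (by omega)
  obtain ⟨v, hv⟩ := contraExtend (liftQ_inj f g h) (Submodule.mkQ_surjective _) (liftQ_ex f g h) h1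
    ((LinearMap.range f).liftQ u (by
      rintro _ ⟨x, rfl⟩
      exact LinearMap.congr_fun hu x))
  refine ⟨v, ?_⟩
  ext x
  have := LinearMap.congr_fun hv (Submodule.Quotient.mk x)
  simpa using this

end lemD

section trace
variable {R : Type} [CommRing R] [Nontrivial R]
variable {T N : Type} [AddCommGroup T] [Module R T] [Module.Free R T] [Module.Finite R T]
  [AddCommGroup N] [Module R N]

theorem trace_rep (f : (T →ₗ[R] N) →ₗ[R] R) :
    ∃ ψ : N →ₗ[R] T, ∀ g : T →ₗ[R] N, f g = LinearMap.trace R T (ψ ∘ₗ g) := by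
  classical
  let b := Module.finBasis R T
  refine ⟨∑ k, (f ∘ₗ (LinearMap.smulRightₗ (b.coord k))).smulRight (b k), fun g => ?_⟩
  have hg : g = ∑ k, (b.coord k).smulRight (g (b k)) := by
    apply b.ext
    intro i
    simp [LinearMap.sum_apply, Finsupp.single_apply]
  conv_lhs => rw [hg]
  have hs : (∑ k, (f ∘ₗ (LinearMap.smulRightₗ (b.coord k))).smulRight (b k)) ∘ₗ g =
      ∑ k, ((f ∘ₗ (LinearMap.smulRightₗ (b.coord k))).smulRight (b k)) ∘ₗ g := by
    ext x; simp [LinearMap.sum_apply]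
  rw [map_sum, hs, map_sum]
  refine Finset.sum_congr rfl fun k _ => ?_
  have : ((f ∘ₗ (LinearMap.smulRightₗ (b.coord k))).smulRight (b k)) ∘ₗ g =
    ((f ∘ₗ (LinearMap.smulRightₗ (b.coord k))) ∘ₗ g).smulRight (b k) := by
    ext x; simp
  rw [this, LinearMap.trace_smulRight]
  simp

theorem trace_nondeg (φ ψ : N →ₗ[R] T)
    (h : ∀ g : T →ₗ[R] N, LinearMap.trace R T (φ ∘ₗ g) = LinearMap.trace R T (ψ ∘ₗ g)) :
    φ = ψ := by
  ext x
  let b := Module.finBasis R T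
  apply b.ext_elem
  intro i
  have := h ((b.coord i).smulRight x)
  have h1 : ∀ φ : N →ₗ[R] T, φ ∘ₗ ((b.coord i).smulRight x) = (b.coord i).smulRight (φ x) := by
    intro φ; ext y; simp
  rw [h1, h1, LinearMap.trace_smulRight, LinearMap.trace_smulRight] at this
  exact this

end trace

section free
variable {R : Type} [CommRing R] [Nontrivial R]
variable {T N D : Type} [AddCommGroup T] [Module R T] [Module.Free R T] [Module.Finite R T]
  [AddCommGroup N] [Module R N] [AddCommGroup D] [Module R D]

theorem ev_free_right {n : ℕ} (h : EV R N R n) : EV R N T n :=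
  ev_equiv_right (Module.finBasis R T).equivFun.symm (ev_pi_right h _)

theorem ev_hom_left {n : ℕ} (h : EV R N D n) : EV R (T →ₗ[R] N) D n :=
  ev_equiv_left ((Module.finBasis R T).constr R) (ev_pi_left h _)

theorem fin_hom [Module.Finite R N] : Module.Finite R (T →ₗ[R] N) :=
  Module.Finite.equiv ((Module.finBasis R T).constr R)

end free
end S11

namespace S11
section tate
variable {R : Type} [CommRing R] [IsLocalRing R] [IsNoetherianRing R]
variable (T : ℤ → Type) [∀ i, AddCommGroup (T i)] [∀ i, Module R (T i)]
  (d : ∀ i, T (i+1) →ₗ[R] T i)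

/-- Vanishing of the Tate cohomology in degree `i+1`. -/
def TV (A : Type) [AddCommGroup A] [Module R A] (i : ℤ) : Prop :=
  ∀ f : T (i+1) →ₗ[R] A, f ∘ₗ d (i+1) = 0 → ∃ g : T i →ₗ[R] A, g ∘ₗ d i = f

variable {T d}
variable {N : Type} [AddCommGroup N] [Module R N]

theorem TV_pi {i : ℤ} (h : TV T d R i) (b : ℕ) : TV T d (Fin b → R) i := by
  intro f hf
  have h1 : ∀ k, ∃ g : T i →ₗ[R] R, g ∘ₗ d i = (LinearMap.proj k) ∘ₗ f := fun k =>
    h _ (by rw [LinearMap.comp_assoc, hf, LinearMap.comp_zero])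
  choose g hg using h1
  refine ⟨LinearMap.pi g, ?_⟩
  ext x k
  exact LinearMap.congr_fun (hg k) x

variable [∀ i, Module.Free R (T i)] [∀ i, Module.Finite R (T i)]

theorem TV_shift (hd : ∀ i, Function.Exact (d (i+1)) (d i)) {b : ℕ} (p : (Fin b → R) →ₗ[R] N)
    (hp : Function.Surjective p) {i : ℤ} (hR : TV T d R (i+1)) (hN : TV T d N i) :
    TV T d (LinearMap.ker p) (i+1) := by
  intro f hf
  obtain ⟨g, hg⟩ := TV_pi hR b ((LinearMap.ker p).subtype ∘ₗ f)
    (by rw [LinearMap.comp_assoc, hf, LinearMap.comp_zero])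
  obtain ⟨h, hh⟩ := hN (p ∘ₗ g) (by
    rw [LinearMap.comp_assoc, hg]
    ext x
    exact (f x).2)
  obtain ⟨h', hh'⟩ := Module.projective_lifting_property p h hp
  refine ⟨(g - h' ∘ₗ d i).codRestrict _ (fun x => ?_), ?_⟩
  · have h1 := LinearMap.congr_fun hh x
    have h2 := LinearMap.congr_fun hh' (d i x)
    simp only [LinearMap.comp_apply] at h1 h2
    simp [LinearMap.mem_ker, map_sub, h1, h2]
  · ext x : 1
    apply Subtype.ext
    have h1 := LinearMap.congr_fun hg x
    have h2 : d i (d (i+1) x) = 0 := (hd i).apply_apply_eq_zero x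
    simp only [LinearMap.comp_apply] at h1
    simp [h1, h2]

theorem ev_syz {b : ℕ} (p : (Fin b → R) →ₗ[R] N) (hp : Function.Surjective p)
    (B : Type) [AddCommGroup B] [Module R B] (j : ℕ) :
    EV R (LinearMap.ker p) B (j+1) ↔ EV R N B (j+2) :=
  ⟨fun h => contra3 (Submodule.subtype_injective _) hp (ker_exact p) h (ev_proj _),
    fun h => contra1 (Submodule.subtype_injective _) hp (ker_exact p) (ev_proj _) h⟩

theorem exists_syz (hd : ∀ i, Function.Exact (d (i+1)) (d i)) (hR : ∀ i, TV T d R i) :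
    ∀ (s : ℕ) (N : Type) [AddCommGroup N] [Module R N] [Module.Finite R N],
    ∃ (N' : Type) (_ : AddCommGroup N') (_ : Module R N') (_ : Module.Finite R N'),
      (∀ (B : Type) [AddCommGroup B] [Module R B] (j : ℕ), EV R N' B (j+1) ↔ EV R N B (j+1+s)) ∧
      (∀ c : ℤ, (∀ i ≤ c, TV T d N i) → ∀ i ≤ c + s, TV T d N' i) := by
  intro s
  induction s with
  | zero =>
    intro N _ _ _
    exact ⟨N, _, _, inferInstance, fun B _ _ j => Iff.rfl, fun c h i hi => h i (by simpa using hi)⟩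
  | succ s ih =>
    intro N _ _ _
    obtain ⟨b, p, hp⟩ := Module.Finite.exists_fin' R N
    obtain ⟨N', _, _, _, h1, h2⟩ := ih (LinearMap.ker p)
    refine ⟨N', _, _, inferInstance, fun B _ _ j => ?_, fun c h i hi => ?_⟩
    · rw [h1, show j + 1 + s = (j + s) + 1 by omega, ev_syz p hp,
        show j + s + 2 = j + 1 + (s+1) by omega]
    · refine h2 (c+1) (fun i hi => ?_) i (by push_cast at hi; linarith)
      obtain ⟨i, rfl⟩ : ∃ i', i = i' + 1 := ⟨i-1, by ring⟩
      exact TV_shift hd p hp (hR _) (h i (by linarith))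

theorem lcomp_exact (hd : ∀ i, Function.Exact (d (i+1)) (d i)) {i : ℤ} (h : TV T d N i) :
    Function.Exact (LinearMap.lcomp R N (d i)) (LinearMap.lcomp R N (d (i+1))) := by
  intro f
  constructor
  · intro hf
    obtain ⟨g, hg⟩ := h f hf
    exact ⟨g, hg⟩
  · rintro ⟨g, rfl⟩
    ext x
    have h2 : d i (d (i+1) x) = 0 := (hd i).apply_apply_eq_zero x
    simp [h2]

theorem hom_good (hd : ∀ i, Function.Exact (d (i+1)) (d i)) [Module.Finite R N]
    (hN : ∀ j, EV R N R (j+1)) {c : ℤ}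
    (hTV : ∀ i ≤ c, TV T d N i) : ∀ (m : ℕ) (i : ℤ), i + m ≤ c + 1 →
    Good R m (ModuleCat.of R (T i →ₗ[R] N)) (ModuleCat.of R (T (i+1) →ₗ[R] N))
      (LinearMap.lcomp R N (d i)) := by
  intro m
  induction m with
  | zero => intro i _; trivial
  | succ m ih =>
    intro i hi
    push_cast at hi
    exact ⟨ModuleCat.of R (T (i+1+1) →ₗ[R] N), LinearMap.lcomp R N (d (i+1)),
      lcomp_exact hd (hTV i (by omega)), fin_hom, fun j => ev_hom_left (hN j),
      ih (i+1) (by linarith)⟩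

theorem hom_lift {t : ℕ} (ht : IsTop R t) (hd : ∀ i, Function.Exact (d (i+1)) (d i))
    [Module.Finite R N]
    (hN : ∀ j, EV R N R (j+1)) (hTV : ∀ i ≤ (t : ℤ) - 1, TV T d N i) (i : ℤ) (hi : i + 1 ≤ 0)
    (φ : N →ₗ[R] T (i+1)) (hφ : d i ∘ₗ φ = 0) : ∃ ψ : N →ₗ[R] T (i+1+1), d (i+1) ∘ₗ ψ = φ := by
  have hG := hom_good hd hN hTV t (i+1) (by linarith)
  have := fin_hom (R := R) (T := T (i+1+1)) (N := N)
  obtain ⟨v, hv⟩ := good_extend ht (LinearMap.lcomp R N (d i)) (LinearMap.lcomp R N (d (i+1)))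
    (lcomp_exact hd (hTV i (by linarith))) hG
    (LinearMap.trace R (T (i+1)) ∘ₗ LinearMap.llcomp R (T (i+1)) N (T (i+1)) φ) (by
      ext g
      simp only [LinearMap.comp_apply, LinearMap.lcomp_apply', LinearMap.llcomp_apply',
        LinearMap.zero_apply]
      rw [← LinearMap.comp_assoc, LinearMap.trace_comp_comm', ← LinearMap.comp_assoc, hφ,
        LinearMap.zero_comp, map_zero])
  obtain ⟨ψ, hψ⟩ := trace_rep v
  refine ⟨ψ, trace_nondeg _ _ fun g => ?_⟩
  have h1 := LinearMap.congr_fun hv g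
  simp only [LinearMap.comp_apply, LinearMap.lcomp_apply', LinearMap.llcomp_apply'] at h1
  rw [← h1, hψ, LinearMap.comp_assoc, LinearMap.trace_comp_comm', LinearMap.comp_assoc]

theorem ev_ker_T {t : ℕ} (ht : IsTop R t) (hd : ∀ i, Function.Exact (d (i+1)) (d i))
    [Module.Finite R N]
    (hN : ∀ j, EV R N R (j+1)) (hTV : ∀ i ≤ (t : ℤ) - 1, TV T d N i) :
    ∀ (j : ℕ) (n : ℕ) (i : ℤ), i ≤ n → EV R N (LinearMap.ker (d i)) (j + 1 + n) := by
  have step : ∀ (i : ℤ) (j : ℕ), EV R N (LinearMap.ker (d i)) j →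
      EV R N (LinearMap.ker (d (i+1))) (j+1) := fun i j h =>
    co1 (Submodule.subtype_injective _) (kmap_surj _ _ (hd i)) (kmap_exact _ _ (hd i)) h
      (ev_free_right (hN j))
  have h1 : ∀ (j : ℕ) (i : ℤ), i ≤ 0 → EV R N (LinearMap.ker (d i)) (j+1) := by
    intro j
    induction j with
    | zero =>
      intro i hi
      obtain ⟨i, rfl⟩ : ∃ i', i = i' + 1 := ⟨i-1, by ring⟩
      refine coSurj (Submodule.subtype_injective _) (kmap_surj _ _ (hd i))
        (kmap_exact _ _ (hd i)) (fun u => ?_) (ev_free_right (hN 0))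
      obtain ⟨v, hv⟩ := hom_lift ht hd hN hTV i hi ((LinearMap.ker (d i)).subtype ∘ₗ u) (by
        ext x
        exact (u x).2)
      refine ⟨v, ?_⟩
      ext x
      exact LinearMap.congr_fun hv x
    | succ j ih =>
      intro i hi
      obtain ⟨i, rfl⟩ : ∃ i', i = i' + 1 := ⟨i-1, by ring⟩
      exact step i _ (ih i (by linarith))
  intro j n
  induction n with
  | zero => intro i hi; exact h1 j i (by simpa using hi)
  | succ n ih =>
    intro i hi
    obtain ⟨i, rfl⟩ : ∃ i', i = i' + 1 := ⟨i-1, by ring⟩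
    exact step i _ (ih i (by push_cast at hi; linarith))

variable {P : ℤ → Type} [∀ i, AddCommGroup (P i)] [∀ i, Module R (P i)]
  {dP : ∀ i, P (i+1) →ₗ[R] P i} [∀ i, Module.Free R (P i)] [∀ i, Module.Finite R (P i)]

theorem ev_ker_P (hd : ∀ i, 0 ≤ i → Function.Exact (dP (i+1)) (dP i))
    (hN : ∀ j, EV R N R (j+1)) : ∀ (n : ℕ), (∀ j, EV R N (LinearMap.ker (dP n)) (j+1+n)) →
    ∀ j, EV R N (LinearMap.ker (dP 0)) (j+1) := by
  intro n
  induction n with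
  | zero => intro h j; exact h j
  | succ n ih =>
    intro h
    refine ih fun j => ?_
    have h0 := hd n (by omega)
    refine co3 (Submodule.subtype_injective _) (kmap_surj _ _ h0)
      (kmap_exact _ _ h0) (ev_free_right ?_) (h j)
    rw [show j + 1 + n = (j + n) + 1 by omega]
    exact hN _

variable {M : Type} [AddCommGroup M] [Module R M]
variable {P0 P1 : Type} [AddCommGroup P0] [Module R P0] [Module.Free R P0] [Module.Finite R P0]
  [AddCommGroup P1] [Module R P1] [Module.Free R P1] [Module.Finite R P1]

theorem ev_M (d0 : P1 →ₗ[R] P0) (π : P0 →ₗ[R] M) (hπ : Function.Surjective π)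
    (hd : Function.Exact d0 π) (hN : ∀ j, EV R N R (j+1))
    (h : ∀ j, EV R N (LinearMap.ker d0) (j+1)) (j : ℕ) : EV R N M (j+1) := by
  have h1 : ∀ j, EV R N (LinearMap.ker π) (j+1) := fun j =>
    co3 (Submodule.subtype_injective _) (kmap_surj _ _ hd)
      (kmap_exact _ _ hd) (ev_free_right (hN _)) (h (j+1))
  exact co3 (Submodule.subtype_injective _) hπ (ker_exact π) (ev_free_right (hN _)) (h1 (j+1))

theorem sum_smul_mem {E : Type*} [AddCommGroup E] [Module R E] {ι : Type*} (s : Finset ι)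
    (c : ι → R) (hc : ∀ i, c i ∈ IsLocalRing.maximalIdeal R) (x : ι → E) :
    ∑ i ∈ s, c i • x i ∈ (IsLocalRing.maximalIdeal R • ⊤ : Submodule R E) :=
  Submodule.sum_mem _ fun i _ => Submodule.smul_mem_smul (hc i) trivial

theorem nonvan [Module.Finite R N] [Module.Finite R M] [Nontrivial M]
    (d0 : P1 →ₗ[R] P0) (π : P0 →ₗ[R] M) (hπ : Function.Surjective π)
    (hd : Function.Exact d0 π) {s : ℕ} (hK : EV R N (LinearMap.ker d0) (s+1))
    (hM : EV R N M s) : EV R N R s := by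
  classical
  -- a surjection from M to the residue field
  obtain ⟨q, hq⟩ : ∃ q : P0 →ₗ[R] R ⧸ IsLocalRing.maximalIdeal R, Function.Surjective q ∧
      q ∘ₗ d0 = 0 := by
    obtain ⟨L, hL, -⟩ := (eq_top_or_exists_le_coatom (⊥ : Submodule R M)).resolve_left bot_ne_top
    have hs : IsSimpleModule R (M ⧸ L) := isSimpleModule_iff_isCoatom.2 hL
    obtain ⟨I, hI, ⟨e⟩⟩ := isSimpleModule_iff_quot_maximal.1 hs
    obtain rfl := IsLocalRing.eq_maximalIdeal hI
    refine ⟨e.toLinearMap ∘ₗ L.mkQ ∘ₗ π, ?_, ?_⟩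
    · exact e.surjective.comp ((Submodule.mkQ_surjective L).comp hπ)
    · ext x
      have := hd.apply_apply_eq_zero x
      simp [this]
  obtain ⟨φ, hφ⟩ := Module.projective_lifting_property
    (Submodule.mkQ (IsLocalRing.maximalIdeal R)) q (Submodule.mkQ_surjective _)
  obtain ⟨y, hy⟩ : ∃ y, φ y = 1 := by
    obtain ⟨y, hy⟩ := hq.1 1
    have h1 : Submodule.mkQ (IsLocalRing.maximalIdeal R) (φ y) = 1 := by
      rw [← hy]; exact LinearMap.congr_fun hφ y
    have h2 : IsUnit (φ y) := by
      by_contra hcon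
      have h3 : φ y ∈ IsLocalRing.maximalIdeal R := hcon
      have h4 : Submodule.mkQ (IsLocalRing.maximalIdeal R) (φ y) = 0 :=
        (Submodule.Quotient.mk_eq_zero _).2 h3
      rw [h4] at h1
      exact zero_ne_one h1
    obtain ⟨u, hu⟩ := h2
    exact ⟨(↑u⁻¹ : R) • y, by rw [map_smul, ← hu]; simp⟩
  let σ : R →ₗ[R] P0 := LinearMap.toSpanSingleton R P0 y
  have hσ : φ ∘ₗ σ = LinearMap.id := by ext; simp [σ, hy]
  have hmem : ∀ x, φ (d0 x) ∈ IsLocalRing.maximalIdeal R := by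
    intro x
    have h1 := LinearMap.congr_fun hφ (d0 x)
    have h2 := LinearMap.congr_fun hq.2 x
    simp only [LinearMap.comp_apply, LinearMap.zero_apply] at h1 h2
    rw [h2] at h1
    exact (Submodule.Quotient.mk_eq_zero _).1 h1
  have : Module.Finite R (Abelian.Ext (ModuleCat.of R N) (ModuleCat.of R R) s) := inferInstance
  refine nak0 (R := R) fun e => ?_
  obtain ⟨e1, he1⟩ : ∃ e1 : Abelian.Ext (ModuleCat.of R N) (ModuleCat.of R P0) s,
      e1.comp (Abelian.Ext.mk₀ (ModuleCat.ofHom φ)) (add_zero s) = e := by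
    refine ⟨e.comp (Abelian.Ext.mk₀ (ModuleCat.ofHom σ)) (add_zero s), ?_⟩
    rw [Abelian.Ext.comp_assoc_of_second_deg_zero, Abelian.Ext.mk₀_comp_mk₀, ← ModuleCat.ofHom_comp,
      hσ]
    exact Abelian.Ext.comp_mk₀_id e
  obtain ⟨e2, he2⟩ := coEx2 (Submodule.subtype_injective _) hπ (ker_exact π) hM e1
  obtain ⟨e3, he3⟩ := coEx3 (Submodule.subtype_injective _) (kmap_surj _ _ hd)
    (kmap_exact _ _ hd) hK e2
  let b := Module.finBasis R P1
  have hfac : ModuleCat.ofHom (kmap d0 π hd) ≫ ModuleCat.ofHom (LinearMap.ker π).subtype ≫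
      ModuleCat.ofHom φ = ∑ i, φ (d0 (b i)) • ModuleCat.ofHom (b.coord i) := by
    apply ModuleCat.hom_ext
    apply b.ext
    intro i
    rw [ModuleCat.hom_sum, LinearMap.sum_apply]
    simp only [ModuleCat.hom_comp, ModuleCat.hom_ofHom, ModuleCat.hom_smul, LinearMap.smul_apply,
      LinearMap.comp_apply]
    rw [Finset.sum_eq_single i]
    · simp [kmap]
      rfl
    · intro j _ hj
      simp [Finsupp.single_apply, hj.symm]
    · simp
  have : e = ∑ i, φ (d0 (b i)) • e3.comp (Abelian.Ext.mk₀ (ModuleCat.ofHom (b.coord i)))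
      (add_zero s) := by
    rw [← he1, ← he2, ← he3, Abelian.Ext.comp_assoc_of_second_deg_zero,
      Abelian.Ext.comp_assoc_of_second_deg_zero, Abelian.Ext.mk₀_comp_mk₀, Abelian.Ext.mk₀_comp_mk₀,
      hfac, Abelian.Ext.mk₀_sum, Abelian.Ext.comp_sum]
    simp [Abelian.Ext.mk₀_smul]
  rw [this]
  exact sum_smul_mem _ _ (fun i => hmem _) _

end tate
end S11

namespace S11
section partB
variable {R : Type} [CommRing R] [IsLocalRing R] [IsNoetherianRing R]

theorem free_of_proj (X : ModuleCat.{0} R) (h : Projective X) (hf : Module.Finite R X) :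
    Module.Free R X := by
  have h1 : Module.Projective R X := (IsProjective.iff_projective X).2 h
  exact Module.free_of_flat_of_isLocalRing

theorem prev_down (i : ℤ) : (ComplexShape.down ℤ).prev i = i + 1 := by
  apply ComplexShape.prev_eq'; simp
theorem next_down (i : ℤ) : (ComplexShape.down ℤ).next (i + 1) = i := by
  apply ComplexShape.next_eq'; simp

/-- The kernels are isomorphic where the comparison map is an isomorphism. -/
theorem ker_equiv {A B A' B' : ModuleCat.{0} R} (f : A ⟶ B) (g : A' ⟶ B') (a : A ⟶ A') (b : B ⟶ B')
    (ha : IsIso a) (hb : IsIso b) (h : a ≫ g = f ≫ b) :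
    Nonempty (LinearMap.ker f.hom ≃ₗ[R] LinearMap.ker g.hom) := by
  let ea := (asIso a).toLinearEquiv
  let eb := (asIso b).toLinearEquiv
  have h' : ∀ x, g.hom (ea x) = eb (f.hom x) := fun x => by
    have := LinearMap.congr_fun (congrArg ModuleCat.Hom.hom h) x
    exact this
  refine ⟨LinearEquiv.ofSubmodules ea _ _ ?_⟩
  ext y
  simp only [Submodule.mem_map, LinearMap.mem_ker]
  constructor
  · rintro ⟨x, hx, rfl⟩
    erw [h', hx, map_zero]
  · intro hy
    refine ⟨ea.symm y, ?_, ea.apply_symm_apply y⟩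
    apply eb.injective
    erw [← h', ea.apply_symm_apply, hy, map_zero]

theorem partB {t : ℕ} (ht : IsTop R t)
    {M N : Type} [AddCommGroup M] [Module R M] [Module.Finite R M] [Nontrivial M]
    [AddCommGroup N] [Module R N] [Module.Finite R N] [Nontrivial N]
    (e : ℕ) (he : e ≤ t) (hS : S R N (t - e)) (C : CompleteResolution R (ModuleCat.of R M))
    (hvan : ∀ i : ℤ, i ≤ (e : ℤ) → IsZero (TateExt R C (ModuleCat.of R N) i)) :
    ¬ EV R N M (t - e) ∧ ∀ i, t - e < i → EV R N M i := by
  let T : ℤ → Type := fun i => C.T.X i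
  let d : ∀ i, T (i+1) →ₗ[R] T i := fun i => (C.T.d (i+1) i).hom
  have iF : ∀ i, Module.Finite R (T i) := C.fgT
  have iFr : ∀ i, Module.Free R (T i) := fun i => free_of_proj _ (C.projT i) (C.fgT i)
  let P : ℤ → Type := fun i => C.P.X i
  let dP : ∀ i, P (i+1) →ₗ[R] P i := fun i => (C.P.d (i+1) i).hom
  have jF : ∀ i, Module.Finite R (P i) := C.fgP
  have jFr : ∀ i, Module.Free R (P i) := fun i => free_of_proj _ (C.projP i) (C.fgP i)
  have hd : ∀ i, Function.Exact (d (i+1)) (d i) := fun i =>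
    (exactAt_fun C.T (i+1+1) (i+1) i (prev_down _) (next_down _)).1 (C.exactT (i+1))
  have hdP : ∀ i, 0 ≤ i → Function.Exact (dP (i+1)) (dP i) := fun i hi =>
    (exactAt_fun C.P (i+1+1) (i+1) i (prev_down _) (next_down _)).1 (C.exactP (i+1) (by omega))
  have key : ∀ (A : Type) [AddCommGroup A] [Module R A] (i : ℤ),
      (C.T.linearYonedaObj R (ModuleCat.of R A)).ExactAt (i+1) → TV T d A i := by
    intro A _ _ i h f hf
    obtain ⟨g, hg⟩ := (yo_exact_iff C.T (ModuleCat.of R A) i (i+1) (i+1+1)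
      (by apply ComplexShape.prev_eq'; simp) (by apply ComplexShape.next_eq'; simp)).1 h
      (ModuleCat.ofHom f) (by
        apply ModuleCat.hom_ext
        exact hf)
    exact ⟨g.hom, congrArg ModuleCat.Hom.hom hg⟩
  have hR : ∀ i, TV T d R i := fun i => key R i (C.exactTdual (i+1))
  have hNv : ∀ i ≤ (e : ℤ) - 1, TV T d N i := fun i hi => key N i
    ((HomologicalComplex.exactAt_iff_isZero_homology _ _).2 (hvan (i+1) (by omega)))
  obtain ⟨N', _, _, _, h1, h2⟩ := exists_syz hd hR (t - e) N
  have hN' : ∀ j, EV R N' R (j+1) := fun j => (h1 R j).2 (hS.2 _ (by omega))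
  have hT := ev_ker_T ht hd hN' (fun i hi => h2 _ hNv i (by push_cast [he]; linarith))
  obtain ⟨n0, hn0⟩ := C.iso_eventually
  have hP : ∀ j, EV R N' (LinearMap.ker (dP 0)) (j+1) := by
    refine ev_ker_P hdP hN' n0.toNat fun j => ?_
    obtain ⟨eq⟩ := ker_equiv (C.T.d ((n0.toNat : ℤ)+1) n0.toNat) (C.P.d ((n0.toNat : ℤ)+1) n0.toNat)
      (C.θ.f _) (C.θ.f _) (hn0 _ (by omega)) (hn0 _ (by omega)) (C.θ.comm _ _)
    exact ev_equiv_right eq (hT j _ _ le_rfl)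
  have hπ : Function.Surjective C.π.hom := (ModuleCat.epi_iff_surjective _).1 C.epiπ
  have hex : Function.Exact (dP 0) C.π.hom :=
    (ShortComplex.ShortExact.moduleCat_exact_iff_function_exact _).1 C.exact0
  have hM := ev_M (M := M) (dP 0) C.π.hom hπ hex hN' hP
  refine ⟨fun h => hS.1 ?_, fun i hi => ?_⟩
  · refine nonvan (M := M) (dP 0) C.π.hom hπ hex ?_ h
    have := (h1 _ 0).1 (hP 0)
    rwa [show 0 + 1 + (t - e) = t - e + 1 by omega] at this
  · have := (h1 M (i - (t-e) - 1)).1 (hM _)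
    rwa [show i - (t-e) - 1 + 1 + (t - e) = i by omega] at this

end partB
end S11

namespace S11
section partC
variable {R : Type} [CommRing R] [IsLocalRing R] [IsNoetherianRing R]

/-- A map of finite free modules. -/
structure St (R : Type) [CommRing R] where
  x : ℕ
  y : ℕ
  f : (Fin x → R) →ₗ[R] (Fin y → R)

theorem next_exists (s : St R) : ∃ (b : ℕ) (p : (Fin b → R) →ₗ[R] (Fin s.x → R)),
    Function.Exact p s.f := by
  obtain ⟨b, p, hp⟩ := Module.Finite.exists_fin' R (LinearMap.ker s.f)
  refine ⟨b, (LinearMap.ker s.f).subtype ∘ₗ p, ?_⟩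
  rw [LinearMap.exact_iff, LinearMap.range_comp, LinearMap.range_eq_top.2 hp]
  simp

/-- One more step of a free resolution. -/
def St.next (s : St R) : St R :=
  ⟨(next_exists s).choose, s.x, (next_exists s).choose_spec.choose⟩

theorem St.next_exact (s : St R) : Function.Exact s.next.f s.f :=
  (next_exists s).choose_spec.choose_spec

theorem exists_res (A : Type) [AddCommGroup A] [Module R A] [Module.Finite R A] :
    ∃ (a : ℕ → ℕ) (d : ∀ n, (Fin (a (n+1)) → R) →ₗ[R] (Fin (a n) → R))
      (π : (Fin (a 0) → R) →ₗ[R] A), Function.Surjective π ∧ Function.Exact (d 0) π ∧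
      ∀ n, Function.Exact (d (n+1)) (d n) := by
  obtain ⟨a0, π, hπ⟩ := Module.Finite.exists_fin' R A
  obtain ⟨a1, p, hp⟩ := Module.Finite.exists_fin' R (LinearMap.ker π)
  have hex : Function.Exact ((LinearMap.ker π).subtype ∘ₗ p) π := by
    rw [LinearMap.exact_iff, LinearMap.range_comp, LinearMap.range_eq_top.2 hp]
    simp
  let s : ℕ → St R := fun n => Nat.rec ⟨a1, a0, (LinearMap.ker π).subtype ∘ₗ p⟩ (fun _ s => s.next) n
  exact ⟨fun n => (s n).y, fun n => (s n).f, π, hπ, hex, fun n => (s n).next_exact⟩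

/-- The transpose of a map of finite free modules. -/
def tr {x y : ℕ} (f : (Fin x → R) →ₗ[R] (Fin y → R)) : (Fin y → R) →ₗ[R] (Fin x → R) :=
  Matrix.toLin' (LinearMap.toMatrix' f).transpose

theorem tr_tr {x y : ℕ} (f : (Fin x → R) →ₗ[R] (Fin y → R)) : tr (tr f) = f := by
  simp [tr]

theorem tr_dot {x y : ℕ} (f : (Fin x → R) →ₗ[R] (Fin y → R)) (v : Fin y → R) (w : Fin x → R) :
    tr f v ⬝ᵥ w = v ⬝ᵥ f w := by
  have : f w = (LinearMap.toMatrix' f).mulVec w := by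
    rw [← Matrix.toLin'_apply, Matrix.toLin'_toMatrix']
  rw [this, tr, Matrix.toLin'_apply, Matrix.mulVec_transpose, Matrix.dotProduct_mulVec]

/-- The functional given by pairing with a vector. -/
def dot {x : ℕ} (v : Fin x → R) : (Fin x → R) →ₗ[R] R := dotProductBilin R R v

theorem dot_apply {x : ℕ} (v w : Fin x → R) : dot v w = v ⬝ᵥ w := rfl

theorem exists_dot {x : ℕ} (u : (Fin x → R) →ₗ[R] R) : ∃ v, u = dot v := by
  refine ⟨fun i => u (Pi.single i 1), ?_⟩
  ext i
  simp [dot_apply]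

theorem dot_inj {x : ℕ} {v w : Fin x → R} (h : ∀ z, v ⬝ᵥ z = w ⬝ᵥ z) : v = w :=
  dotProduct_eq v w h

theorem tr_exact {t : ℕ} (ht : IsTop R t) {x y z : ℕ} (f : (Fin x → R) →ₗ[R] (Fin y → R))
    (g : (Fin y → R) →ₗ[R] (Fin z → R)) (h : Function.Exact f g)
    (hG : Good R t (ModuleCat.of R (Fin y → R)) (ModuleCat.of R (Fin z → R)) g) :
    Function.Exact (tr g) (tr f) := by
  intro v
  constructor
  · intro hv
    obtain ⟨w, hw⟩ := good_extend ht f g h hG (dot v) (by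
      ext1 i
      ext
      simp only [LinearMap.comp_apply, dot_apply, ← tr_dot, hv]
      simp)
    obtain ⟨w', rfl⟩ := exists_dot w
    refine ⟨w', dot_inj fun z => ?_⟩
    rw [tr_dot]
    exact LinearMap.congr_fun hw z
  · rintro ⟨w, rfl⟩
    refine dot_inj fun z => ?_
    rw [tr_dot, tr_dot, h.apply_apply_eq_zero]
    simp

abbrev GoodF (R : Type) [CommRing R] (m : ℕ) {x y : ℕ} (f : (Fin x → R) →ₗ[R] (Fin y → R)) : Prop :=
  Good R m (ModuleCat.of R (Fin x → R)) (ModuleCat.of R (Fin y → R)) f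

theorem GoodF.step {m x y z : ℕ} {f : (Fin x → R) →ₗ[R] (Fin y → R)}
    {g : (Fin y → R) →ₗ[R] (Fin z → R)} (h : Function.Exact f g) (hG : GoodF R m g) :
    GoodF R (m+1) f :=
  ⟨ModuleCat.of R (Fin z → R), g, h, inferInstanceAs (Module.Finite R (Fin z → R)),
    fun _ => ev_proj _, hG⟩

/-- Data of an acyclic complex extending a truncated resolution. -/
theorem exists_T {t : ℕ} (ht : IsTop R t) {a : ℕ → ℕ}
    (d : ∀ n, (Fin (a (n+1)) → R) →ₗ[R] (Fin (a n) → R))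
    (hd : ∀ n, Function.Exact (d (n+1)) (d n)) :
    ∃ (b : ℕ → ℕ) (q : ∀ n, (Fin (b n) → R) →ₗ[R] (Fin (b (n+1)) → R))
      (r : (Fin (a t) → R) →ₗ[R] (Fin (b 0) → R)),
      Function.Exact (d t) r ∧ Function.Exact r (q 0) ∧
      ∀ n, Function.Exact (q n) (q (n+1)) := by
  obtain ⟨b, q, π, hπ, hq0, hq⟩ := exists_res (R := R) (LinearMap.ker (tr (d t)))
  let ε : (Fin (b 0) → R) →ₗ[R] (Fin (a t) → R) := (LinearMap.ker (tr (d t))).subtype ∘ₗ π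
  have h0 : Function.Exact (q 0) ε := by
    intro x
    rw [← hq0 x]
    simp [ε]
  have h1 : Function.Exact ε (tr (d t)) := by
    rw [LinearMap.exact_iff, LinearMap.range_comp, LinearMap.range_eq_top.2 hπ]
    simp
  have G1 : ∀ m k, m ≤ k → GoodF R m (d k) := by
    intro m
    induction m with
    | zero => intro k _; trivial
    | succ m ih =>
      intro k hk
      obtain ⟨k, rfl⟩ : ∃ k', k = k' + 1 := ⟨k-1, by omega⟩
      exact GoodF.step (hd k) (ih k (by omega))
  have h2 : ∀ n, Function.Exact (tr (d (t+n))) (tr (d (t+n+1))) := fun n =>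
    tr_exact ht _ _ (hd _) (G1 t _ (by omega))
  have G2 : ∀ m n, GoodF R m (tr (d (t+n))) := by
    intro m
    induction m with
    | zero => intro k; trivial
    | succ m ih => intro n; exact GoodF.step (h2 n) (ih (n+1))
  have G3 : ∀ m, GoodF R m ε := by
    rintro (_ | m)
    · trivial
    · exact GoodF.step h1 (G2 m 0)
  have G4 : ∀ n m, GoodF R m (q n) := by
    intro n
    induction n with
    | zero =>
      rintro (_ | m)
      · trivial
      · exact GoodF.step h0 (G3 m)
    | succ n ih =>
      rintro (_ | m)
      · trivial
      · exact GoodF.step (hq n) (ih m)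
  refine ⟨b, fun n => tr (q n), tr ε, ?_, tr_exact ht _ _ h0 (G3 t),
    fun n => tr_exact ht _ _ (hq n) (G4 n t)⟩
  have := tr_exact ht _ _ h1 (G2 t 0)
  rwa [tr_tr] at this

/-- Ranks of the complete complex. -/
def cT (t : ℕ) (a b : ℕ → ℕ) : ℤ → ℕ
  | Int.ofNat n => a (t+n)
  | Int.negSucc n => b n

/-- Differentials of the complete complex. -/
def dT (t : ℕ) {a b : ℕ → ℕ} (d : ∀ n, (Fin (a (n+1)) → R) →ₗ[R] (Fin (a n) → R))
    (q : ∀ n, (Fin (b n) → R) →ₗ[R] (Fin (b (n+1)) → R))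
    (r : (Fin (a t) → R) →ₗ[R] (Fin (b 0) → R)) :
    ∀ i : ℤ, (Fin (cT t a b (i+1)) → R) →ₗ[R] (Fin (cT t a b i) → R)
  | Int.ofNat n => d (t+n)
  | Int.negSucc 0 => r
  | Int.negSucc (n+1) => q n

/-- Ranks of the resolution. -/
def cP (a : ℕ → ℕ) : ℤ → ℕ
  | Int.ofNat n => a n
  | Int.negSucc _ => 0

/-- Differentials of the resolution. -/
def dP {a : ℕ → ℕ} (d : ∀ n, (Fin (a (n+1)) → R) →ₗ[R] (Fin (a n) → R)) :
    ∀ i : ℤ, (Fin (cP a (i+1)) → R) →ₗ[R] (Fin (cP a i) → R)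
  | Int.ofNat n => d n
  | Int.negSucc _ => 0

theorem dT_exact (t : ℕ) {a b : ℕ → ℕ} (d : ∀ n, (Fin (a (n+1)) → R) →ₗ[R] (Fin (a n) → R))
    (q : ∀ n, (Fin (b n) → R) →ₗ[R] (Fin (b (n+1)) → R))
    (r : (Fin (a t) → R) →ₗ[R] (Fin (b 0) → R))
    (hd : ∀ n, Function.Exact (d (n+1)) (d n)) (h1 : Function.Exact (d t) r)
    (h2 : Function.Exact r (q 0)) (h3 : ∀ n, Function.Exact (q n) (q (n+1))) :
    ∀ i, Function.Exact (dT t d q r (i+1)) (dT t d q r i)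
  | Int.ofNat n => hd (t+n)
  | Int.negSucc 0 => h1
  | Int.negSucc 1 => h2
  | Int.negSucc (n+2) => h3 n

theorem dP_sq {a : ℕ → ℕ} (d : ∀ n, (Fin (a (n+1)) → R) →ₗ[R] (Fin (a n) → R))
    (hd : ∀ n, Function.Exact (d (n+1)) (d n)) : ∀ i, dP d i ∘ₗ dP d (i+1) = 0
  | Int.ofNat n => (hd n).linearMap_comp_eq_zero
  | Int.negSucc _ => LinearMap.zero_comp _

theorem dT_TV {t : ℕ} (ht : IsTop R t) {c : ℤ → ℕ}
    (d : ∀ i : ℤ, (Fin (c (i+1)) → R) →ₗ[R] (Fin (c i) → R))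
    (h : ∀ i, Function.Exact (d (i+1)) (d i)) (i : ℤ) :
    TV (fun i => Fin (c i) → R) d R i := by
  have G : ∀ m i, GoodF R m (d i) := by
    intro m
    induction m with
    | zero => intro k; trivial
    | succ m ih =>
      intro i
      obtain ⟨i, rfl⟩ : ∃ k', i = k' + 1 := ⟨i-1, by ring⟩
      exact GoodF.step (h i) (ih i)
  intro f hf
  exact good_extend ht _ _ (h i) (G t i) f hf

theorem comparison {T P : ℤ → Type} [∀ i, AddCommGroup (T i)] [∀ i, Module R (T i)]
    [∀ i, AddCommGroup (P i)] [∀ i, Module R (P i)]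
    (d : ∀ i, T (i+1) →ₗ[R] T i) (e : ∀ i, P (i+1) →ₗ[R] P i)
    (he : ∀ i, e i ∘ₗ e (i+1) = 0) (hTV : ∀ i j, TV T d (P j) i)
    (θ0 : ∀ i, T i →ₗ[R] P i) (h0 : ∀ i ≥ 0, e i ∘ₗ θ0 (i+1) = θ0 i ∘ₗ d i) (m : ℕ) :
    ∃ θ : ∀ i, T i →ₗ[R] P i, (∀ i ≥ 0, θ i = θ0 i) ∧
      ∀ i ≥ -(m : ℤ), e i ∘ₗ θ (i+1) = θ i ∘ₗ d i := by
  induction m with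
  | zero => exact ⟨θ0, fun _ _ => rfl, by simpa using h0⟩
  | succ m ih =>
    obtain ⟨θ, h1, h2⟩ := ih
    obtain ⟨g, hg⟩ := hTV (-(m:ℤ) - 1) (-(m:ℤ) - 1) (e (-(m:ℤ) - 1) ∘ₗ θ (-(m:ℤ) - 1+1)) (by
      rw [LinearMap.comp_assoc, ← h2 _ (by linarith), ← LinearMap.comp_assoc, he,
        LinearMap.zero_comp])
    refine ⟨Function.update θ _ g, fun i hi => ?_, fun i hi => ?_⟩
    · rw [Function.update_of_ne (by omega), h1 i hi]
    · rw [Function.update_of_ne (by push_cast at hi; omega)]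
      by_cases h : i = -(m:ℤ) - 1
      · subst h
        rw [Function.update_self, hg]
      · rw [Function.update_of_ne h]
        exact h2 i (by push_cast at hi; omega)

end partC
end S11

namespace S11
section partC2
variable {R : Type} [CommRing R] [IsLocalRing R] [IsNoetherianRing R]

/-- Complex from a family. -/
def cpx {c : ℤ → ℕ} (d : ∀ i : ℤ, (Fin (c (i+1)) → R) →ₗ[R] (Fin (c i) → R))
    (h : ∀ i, d i ∘ₗ d (i+1) = 0) : ChainComplex (ModuleCat.{0} R) ℤ :=
  ChainComplex.of (fun i => ModuleCat.of R (Fin (c i) → R)) (fun i => ModuleCat.ofHom (d i))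
    (fun i => by
      rw [← ModuleCat.ofHom_comp, h]
      rfl)

theorem cpx_d {c : ℤ → ℕ} (d : ∀ i : ℤ, (Fin (c (i+1)) → R) →ₗ[R] (Fin (c i) → R))
    (h : ∀ i, d i ∘ₗ d (i+1) = 0) (i : ℤ) : (cpx d h).d (i+1) i = ModuleCat.ofHom (d i) :=
  ChainComplex.of_d (fun i => ModuleCat.of R (Fin (c i) → R)) (fun i => ModuleCat.ofHom (d i)) i

/-- Shifted complex. -/
def shf (T : ChainComplex (ModuleCat.{0} R) ℤ) (t : ℤ) : ChainComplex (ModuleCat.{0} R) ℤ where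
  X i := T.X (i - t)
  d i j := T.d (i - t) (j - t)
  shape i j h := T.shape _ _ (fun h' => h (by
    simp only [ComplexShape.down_Rel] at h' ⊢
    omega))
  d_comp_d' i j k _ _ := T.d_comp_d _ _ _

theorem exactAt_d (T : ChainComplex (ModuleCat.{0} R) ℤ) (i j k : ℤ) (hi : i = j + 1) (hk : j = k+1) :
    T.ExactAt j ↔ Function.Exact (T.d i j).hom (T.d j k).hom :=
  exactAt_fun T i j k (by apply ComplexShape.prev_eq'; simp [hi])
    (by apply ComplexShape.next_eq'; simp [hk])

theorem yoAt_d (T : ChainComplex (ModuleCat.{0} R) ℤ) (A : ModuleCat.{0} R) (h i j : ℤ)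
    (hh : h + 1 = i) (hj : i + 1 = j) :
    (T.linearYonedaObj R A).ExactAt i ↔
      ∀ f : T.X i ⟶ A, T.d j i ≫ f = 0 → ∃ g : T.X h ⟶ A, T.d i h ≫ g = f :=
  yo_exact_iff T A h i j (by apply ComplexShape.prev_eq'; simp [hh])
    (by apply ComplexShape.next_eq'; simp [hj])

theorem exists_complete {t : ℕ} (ht : IsTop R t) (M : Type) [AddCommGroup M] [Module R M]
    [Module.Finite R M] : Nonempty (CompleteResolution R (ModuleCat.of R M)) := by
  obtain ⟨a, d, π, hπ, hd0, hd⟩ := exists_res (R := R) M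
  obtain ⟨b, q, r, h1, h2, h3⟩ := exists_T ht d hd
  have hT := dT_exact t d q r hd h1 h2 h3
  have hTV := dT_TV ht _ hT
  let T := cpx (dT t d q r) (fun i => (hT i).linearMap_comp_eq_zero)
  let P := cpx (dP d) (dP_sq d hd)
  have Tex : ∀ i, T.ExactAt i := by
    intro i
    obtain ⟨i, rfl⟩ : ∃ k', i = k' + 1 := ⟨i-1, by ring⟩
    rw [exactAt_d T (i+1+1) (i+1) i rfl rfl]
    simp only [T, cpx_d]
    exact hT i
  have Pex : ∀ n : ℕ, Function.Exact (P.d ((n:ℤ)+1+1) (n+1)).hom (P.d ((n:ℤ)+1) n).hom := by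
    intro n
    simp only [P, cpx_d]
    exact hd n
  have Tyo : ∀ i (f : T.X (i+1) ⟶ ModuleCat.of R R), T.d (i+1+1) (i+1) ≫ f = 0 →
      ∃ g : T.X i ⟶ ModuleCat.of R R, T.d (i+1) i ≫ g = f := by
    intro i f hf
    simp only [T, cpx_d] at hf ⊢
    obtain ⟨g, hg⟩ := hTV i f.hom (congrArg ModuleCat.Hom.hom hf)
    exact ⟨ModuleCat.ofHom g, ModuleCat.hom_ext hg⟩
  -- comparison map
  obtain ⟨θ, hθ0, hθ⟩ : ∃ θ : ∀ i : ℤ, T.X i ⟶ P.X (t + i), (∀ i ≥ 0, IsIso (θ i)) ∧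
      ∀ i, θ (i+1) ≫ P.d (t + (i+1)) (t + i) = T.d (i+1) i ≫ θ i := by
    let θ0 : ∀ i : ℤ, (Fin (cT t a b i) → R) →ₗ[R] (Fin (cP a (t + i)) → R)
      | Int.ofNat n => LinearMap.id (M := Fin (a (t+n)) → R)
      | Int.negSucc n => 0
    have hz : ∀ n : ℕ, θ0 n = LinearMap.id (M := Fin (a (t+n)) → R) := fun n => rfl
    have hPd : ∀ n : ℕ, (P.d ((t:ℤ) + ((n:ℤ)+1)) (t + (n:ℤ))).hom = d (t+n) := fun n =>
      congrArg ModuleCat.Hom.hom (cpx_d (dP d) (dP_sq d hd) (Int.ofNat (t+n)))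
    obtain ⟨θ, hθ0, hθ⟩ := comparison (R := R) (T := fun i => Fin (cT t a b i) → R)
      (P := fun i => Fin (cP a (t + i)) → R) (dT t d q r)
      (fun i => (P.d (t + (i+1)) (t + i)).hom)
      (fun i => congrArg ModuleCat.Hom.hom (P.d_comp_d (t + (i+1+1)) (t + (i+1)) (t+i)))
      (fun i j => TV_pi (hTV i) _) θ0 (by
        intro i hi
        obtain ⟨n, rfl⟩ := Int.eq_ofNat_of_zero_le hi
        rw [hPd]
        rfl) t
    refine ⟨fun i => ModuleCat.ofHom (θ i), ?_, ?_⟩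
    · intro i hi
      change IsIso (ModuleCat.ofHom (θ i))
      rw [hθ0 i hi]
      obtain ⟨n, rfl⟩ := Int.eq_ofNat_of_zero_le hi
      exact inferInstanceAs (IsIso (𝟙 (ModuleCat.of R (Fin (a (t+n)) → R))))
    · intro i
      by_cases h : -(t:ℤ) ≤ i
      · have := hθ i h
        simp only [T, cpx_d]
        exact ModuleCat.hom_ext this
      · have : cP a (t + i) = 0 := by
          obtain ⟨n, hn⟩ := Int.eq_negSucc_of_lt_zero (show (t:ℤ) + i < 0 by omega)
          rw [hn]; rfl
        have : Subsingleton (Fin (cP a (t + i)) → R) := by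
          rw [this]; infer_instance
        apply ModuleCat.hom_ext
        ext x : 1
        exact Subsingleton.elim (α := Fin (cP a (t + i)) → R) _ _
  have hproj : ∀ n : ℕ, Projective (ModuleCat.of R (Fin n → R)) := fun n => inferInstance
  refine ⟨{
    T := shf T t
    P := P
    θ := { f := fun i => θ (i - t) ≫ (P.XIsoOfEq (by ring)).hom
           comm' := ?_ }
    π := ModuleCat.ofHom π
    projT := fun i => hproj _
    fgT := fun i => inferInstanceAs (Module.Finite R (Fin _ → R))
    projP := fun i => hproj _
    fgP := fun i => inferInstanceAs (Module.Finite R (Fin _ → R))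
    zeroP := ?_
    epiπ := (ModuleCat.epi_iff_surjective _).2 hπ
    wπ := ?_
    exact0 := ?_
    exactP := ?_
    exactT := ?_
    exactTdual := ?_
    iso_eventually := ⟨t, fun i hi => ?_⟩ }⟩
  · rintro i j hij
    obtain rfl : j + 1 = i := hij
    have hk : ∀ k, k = j - t + 1 → θ k ≫ P.d (t + k) (t + (j-t)) = T.d k (j-t) ≫ θ (j-t) := by
      rintro k rfl
      exact hθ _
    have := hk (j + 1 - t) (by ring)
    have h4 : (θ (j + 1 - t) ≫ (P.XIsoOfEq (show (t:ℤ) + (j + 1 - t) = j + 1 by ring)).hom) ≫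
        P.d (j+1) j =
        T.d (j+1-t) (j-t) ≫ θ (j-t) ≫ (P.XIsoOfEq (show (t:ℤ) + (j - t) = j by ring)).hom := by
      rw [Category.assoc, HomologicalComplex.XIsoOfEq_hom_comp_d, ← Category.assoc, ← this,
        Category.assoc, HomologicalComplex.d_comp_XIsoOfEq_hom]
    exact h4
  · intro i hi
    obtain ⟨n, rfl⟩ := Int.eq_negSucc_of_lt_zero hi
    have : Subsingleton (P.X (Int.negSucc n)) := inferInstanceAs (Subsingleton (Fin 0 → R))
    exact ModuleCat.isZero_of_subsingleton _
  · have := cpx_d (dP d) (dP_sq d hd) 0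
    exact (congrArg (· ≫ ModuleCat.ofHom π) this).trans (ModuleCat.hom_ext hd0.linearMap_comp_eq_zero)
  · refine (ShortComplex.ShortExact.moduleCat_exact_iff_function_exact _).2 ?_
    have := cpx_d (dP d) (dP_sq d hd) 0
    change Function.Exact (P.d (0+1) 0).hom π
    rw [this]
    exact hd0
  · intro i hi
    obtain ⟨n, rfl⟩ : ∃ n : ℕ, i = n + 1 := ⟨(i-1).toNat, by omega⟩
    exact (exactAt_d P ((n:ℤ)+1+1) (n+1) n rfl rfl).2 (Pex n)
  · intro i
    refine (exactAt_d (shf T t) (i+1) i (i-1) rfl (by ring)).2 ?_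
    exact (exactAt_d T (i+1-t) (i-t) (i-1-t) (by ring) (by ring)).1 (Tex _)
  · intro i
    refine (yoAt_d (shf T t) _ (i-1) i (i+1) (by ring) rfl).2 ?_
    refine (yoAt_d T _ (i-1-t) (i-t) (i+1-t) (by ring) (by ring)).1 ?_
    obtain ⟨k, hk⟩ : ∃ k, i - t = k + 1 := ⟨i-t-1, by ring⟩
    rw [hk]
    exact (yoAt_d T _ k (k+1) (k+1+1) rfl rfl).2 (Tyo k)
  · have := hθ0 (i - t) (by omega)
    exact inferInstanceAs (IsIso (θ (i - t) ≫ (P.XIsoOfEq _).hom))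

end partC2
end S11

/-- Let `R` be a Gorenstein local ring and `M`, `N` nonzero finitely generated
`R`-modules. If `Êxt^i_R(M,N) = 0` for all `i ≤ depth_R N`, then
`sup{ i | Ext^i_R(N,M) ≠ 0 } = depth R - depth_R N`. -/
theorem stmt_11 (R : Type) [CommRing R] [IsLocalRing R] (hR : IsGorensteinLocalRing R)
    (M N : Type) [AddCommGroup M] [Module R M] [Module.Finite R M] [Nontrivial M]
    [AddCommGroup N] [Module R N] [Module.Finite R N] [Nontrivial N]
    (e : ℕ) (he : moduleDepth R N = (e : ℕ∞))
    (hvan : ∀ (C : CompleteResolution R (ModuleCat.of R M)) (i : ℤ),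
      i ≤ (e : ℤ) → IsZero (TateExt R C (ModuleCat.of R N) i)) :
    sSup {c : ℕ∞ | ∃ i : ℕ, c = i ∧
        ¬ IsZero (ExtMod R i (ModuleCat.of R N) (ModuleCat.of R M))} =
      moduleDepth R R - moduleDepth R N := by
  obtain ⟨_, hNo, hI⟩ := hR
  obtain ⟨t, ht⟩ := S11.exists_top hI
  obtain ⟨het, hS⟩ := S11.S_main ht he
  obtain ⟨C⟩ := S11.exists_complete ht M
  obtain ⟨h1, h2⟩ := S11.partB ht e het hS C (hvan C)
  rw [S11.depth_ring ht, he, ← ENat.natCast_sub]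
  apply le_antisymm
  · refine sSup_le ?_
    rintro _ ⟨i, rfl, hi⟩
    rw [S11.isZero_extMod_iff] at hi
    by_contra hcon
    refine hi (h2 i ?_)
    exact_mod_cast not_le.1 hcon
  · refine le_sSup ⟨t - e, rfl, ?_⟩
    rw [S11.isZero_extMod_iff]
    exact h1
end
end

section
/- Let M be a G-perfect R-module of Gorenstein dimension n over a local ring R, set M† = Ext^n_R(M,R), and let N be a finitely generated R-module. Then for all i ∈ ℤ: (i) Êxt^i_R(M†, N) ≅ T̂or_{n−i−1}^R(M, N); (ii) Êxt^i_R(M, N) ≅ T̂or_{n−i−1}^R(M†, N). -/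
open CategoryTheory CategoryTheory.Limits CategoryTheory.MonoidalCategory Opposite

noncomputable section

universe u

variable (R : Type u) [CommRing R]

namespace TateDual

/-- Extending a locally-constrained sequence indexed by `ℤ` upwards. -/
lemma exists_seq_up {H : ℤ → Type*} (V : ℤ → (∀ i, H i) → Prop)
    (hloc : ∀ N h h', h N = h' N → h (N + 1) = h' (N + 1) → V N h → V N h')
    (m : ℤ) (h0 : ∀ i, H i) (hV0 : ∀ i ≤ m, V i h0)
    (step : ∀ N h, V N h → ∃ c : H (N + 2), V (N + 1) (Function.update h (N + 2) c)) :
    ∃ h, ∀ i, V i h := by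
  let S (k : ℕ) := {h : ∀ i, H i // ∀ i ≤ m + k, V i h}
  have hstep (k : ℕ) (s : S k) : ∃ t : S (k + 1), ∀ i ≤ m + k + 1, t.1 i = s.1 i := by
    obtain ⟨c, hc⟩ := step (m + k) s.1 (s.2 _ le_rfl)
    have hag : ∀ i ≤ m + k + 1, Function.update s.1 (m + k + 2) c i = s.1 i := by
      intro i hi
      rw [Function.update_of_ne]
      lia
    refine ⟨⟨Function.update s.1 (m + k + 2) c, ?_⟩, hag⟩
    intro i hi
    by_cases h : i ≤ m + k
    · exact hloc i s.1 _ (hag i (by lia)).symm (hag (i + 1) (by lia)).symm (s.2 i h)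
    · obtain rfl : i = m + k + 1 := by push_cast at hi; lia
      exact hc
  choose nxt hnxt using hstep
  let s : ∀ k, S k := fun k => Nat.rec (motive := S) ⟨h0, by simpa using hV0⟩ (fun k t => nxt k t) k
  have hs : ∀ k : ℕ, ∀ i ≤ m + k + 1, (s (k + 1)).1 i = (s k).1 i := fun k i hi => hnxt k (s k) i hi
  have hs' : ∀ k l : ℕ, k ≤ l → ∀ i ≤ m + k + 1, (s l).1 i = (s k).1 i := by
    intro k l hkl
    induction l, hkl using Nat.le_induction with
    | base => intros; rfl
    | succ l hl ih =>
      intro i hi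
      rw [hs l i (by lia), ih i hi]
  refine ⟨fun i => (s (i - m).toNat).1 i, fun i => ?_⟩
  refine hloc i (s (i + 1 - m).toNat).1 _ ?_ ?_ ((s (i + 1 - m).toNat).2 i (by lia))
  · exact hs' _ _ (by lia) _ (by lia)
  · rfl

/-- Extending a locally-constrained sequence indexed by `ℤ` downwards. -/
lemma exists_seq_down {H : ℤ → Type*} (V : ℤ → (∀ i, H i) → Prop)
    (hloc : ∀ N h h', h N = h' N → h (N + 1) = h' (N + 1) → V N h → V N h')
    (m : ℤ) (h0 : ∀ i, H i) (hV0 : ∀ i, m ≤ i → V i h0)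
    (step : ∀ N h, V N h → ∃ c : H (N - 1), V (N - 1) (Function.update h (N - 1) c)) :
    ∃ h, ∀ i, V i h := by
  let S (k : ℕ) := {h : ∀ i, H i // ∀ i, m - k ≤ i → V i h}
  have hstep (k : ℕ) (s : S k) : ∃ t : S (k + 1), ∀ i, m - k ≤ i → t.1 i = s.1 i := by
    obtain ⟨c, hc⟩ := step (m - k) s.1 (s.2 _ le_rfl)
    have hag : ∀ i, m - k ≤ i → Function.update s.1 (m - k - 1) c i = s.1 i := by
      intro i hi
      rw [Function.update_of_ne]
      lia
    refine ⟨⟨Function.update s.1 (m - k - 1) c, ?_⟩, hag⟩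
    intro i hi
    by_cases h : m - k ≤ i
    · exact hloc i s.1 _ (hag i (by lia)).symm (hag (i + 1) (by lia)).symm (s.2 i h)
    · obtain rfl : i = m - k - 1 := by push_cast at hi; lia
      exact hc
  choose nxt hnxt using hstep
  let s : ∀ k, S k := fun k => Nat.rec (motive := S) ⟨h0, by simpa using hV0⟩ (fun k t => nxt k t) k
  have hs : ∀ k : ℕ, ∀ i, m - k ≤ i → (s (k + 1)).1 i = (s k).1 i := fun k i hi => hnxt k (s k) i hi
  have hs' : ∀ k l : ℕ, k ≤ l → ∀ i, m - k ≤ i → (s l).1 i = (s k).1 i := by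
    intro k l hkl
    induction l, hkl using Nat.le_induction with
    | base => intros; rfl
    | succ l hl ih =>
      intro i hi
      rw [hs l i (by lia), ih i hi]
  refine ⟨fun i => (s (m - i).toNat).1 i, fun i => ?_⟩
  refine hloc i (s (m - i).toNat).1 _ ?_ ?_ ((s (m - i).toNat).2 i (by lia))
  · rfl
  · exact hs' _ _ (by lia) _ (by lia)

section Homotopy

variable {A : Type*} [Category* A] [Preadditive A]

/-- Degree `-1` maps between complexes. -/
abbrev HFam (X Y : CochainComplex A ℤ) (p : ℤ) : Type _ :=
  ∀ q : ℤ, q + 1 = p → (X.X p ⟶ Y.X q)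

/-- The homotopy relation in degree `p`. -/
def HRel {X Y : CochainComplex A ℤ} (f : X ⟶ Y) (p : ℤ) (h : ∀ p, HFam X Y p) : Prop :=
  f.f p = h p (p - 1) (by simp) ≫ Y.d (p - 1) p + X.d p (p + 1) ≫ h (p + 1) p rfl

lemma hRel_loc {X Y : CochainComplex A ℤ} (f : X ⟶ Y) (N : ℤ) (h h' : ∀ p, HFam X Y p)
    (h1 : h N = h' N) (h2 : h (N + 1) = h' (N + 1)) (H : HRel f N h) : HRel f N h' := by
  unfold HRel at *
  rw [← h1, ← h2]
  exact H

lemma hRel_iff {X Y : CochainComplex A ℤ} (f : X ⟶ Y) (p : ℤ) (h : ∀ p, HFam X Y p)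
    (q r : ℤ) (hq : q + 1 = p) (hr : p + 1 = r) :
    HRel f p h ↔ f.f p = h p q hq ≫ Y.d q p + X.d p r ≫ h r p hr := by
  obtain rfl : q = p - 1 := by lia
  subst hr
  rfl

/-- Homotopy from a family satisfying all relations. -/
lemma homotopy_of_hRel {X Y : CochainComplex A ℤ} (f : X ⟶ Y) (h : ∀ p, HFam X Y p)
    (H : ∀ p, HRel f p h) : Nonempty (Homotopy f 0) := by
  refine ⟨{ hom := fun p q => if hq : q + 1 = p then h p q hq else 0
            zero := fun p q hpq => dif_neg hpq
            comm := fun p => ?_ }⟩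
  rw [dNext_eq _ (i' := p + 1) rfl, prevD_eq _ (j' := p - 1) (by simp)]
  have := H p
  unfold HRel at this
  rw [this]
  simp [add_comm]

/-- The contraction relation in degree `p`. -/
def LowContr (Y : CochainComplex A ℤ) : Prop :=
  ∃ (m : ℤ) (s : ∀ p, HFam Y Y p), ∀ p ≤ m, HRel (𝟙 Y) p s

def HighContr (Y : CochainComplex A ℤ) : Prop :=
  ∃ (m : ℤ) (s : ∀ p, HFam Y Y p), ∀ p, m ≤ p → HRel (𝟙 Y) p s

/-- `Hom(X, F)` is exact. -/
def HomExactInto (X : CochainComplex A ℤ) (F : A) : Prop :=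
  ∀ (i j k : ℤ), i + 1 = j → j + 1 = k → ∀ g : X.X j ⟶ F, X.d i j ≫ g = 0 →
    ∃ c : X.X k ⟶ F, X.d j k ≫ c = g

lemma homotopy_zero_of_lowContr {X Y : CochainComplex A ℤ} (f : X ⟶ Y)
    (hX : ∀ i, HomExactInto X (Y.X i)) (hY : LowContr Y) : Nonempty (Homotopy f 0) := by
  obtain ⟨m, s, hs⟩ := hY
  have key := exists_seq_up (fun p h => HRel f p h) (hRel_loc f) m
    (fun p q hq => f.f p ≫ s p q hq) ?_ ?_
  · obtain ⟨h, hh⟩ := key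
    exact homotopy_of_hRel f h hh
  · intro p hp
    have := hs p hp
    unfold HRel at this ⊢
    rw [HomologicalComplex.id_f] at this
    rw [Category.assoc, ← HomologicalComplex.Hom.comm_assoc, ← Preadditive.comp_add, ← this,
      Category.comp_id]
  · intro N h hN
    obtain ⟨c, hc⟩ := hX (N + 1) N (N + 1) (N + 2) rfl (by ring)
      (f.f (N + 1) - h (N + 1) N rfl ≫ Y.d N (N + 1)) (by
        rw [hRel_iff f N h (N - 1) (N + 1) (by simp) rfl] at hN
        rw [Preadditive.comp_sub, ← f.comm, hN]
        simp)
    refine ⟨fun q hq => c ≫ eqToHom (by congr 1; lia), ?_⟩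
    rw [hRel_iff _ _ _ N (N + 2) rfl (by ring)]
    rw [Function.update_self, Function.update_of_ne (by lia)]
    simp [hc]

lemma homotopy_zero_of_highContr {A : Type*} [Category* A] [Abelian A]
    {X Y : CochainComplex A ℤ} (f : X ⟶ Y)
    (hX : ∀ i, Projective (X.X i)) (hc : HighContr X) (hY : Y.Acyclic) :
    Nonempty (Homotopy f 0) := by
  obtain ⟨m, s, hs⟩ := hc
  have key := exists_seq_down (fun p h => HRel f p h) (hRel_loc f) m
    (fun p q hq => s p q hq ≫ f.f q) ?_ ?_
  · obtain ⟨h, hh⟩ := key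
    exact homotopy_of_hRel f h hh
  · intro p hp
    have := hs p hp
    unfold HRel at this ⊢
    rw [HomologicalComplex.id_f] at this
    rw [Category.assoc, HomologicalComplex.Hom.comm, ← Category.assoc, ← Category.assoc,
      ← Preadditive.add_comp, ← this, Category.id_comp]
  · intro N h hN
    have hex := hY (N - 1)
    rw [HomologicalComplex.exactAt_iff' _ (N - 2) (N - 1) N (by simp; ring) (by simp)] at hex
    have hz : (f.f (N - 1) - X.d (N - 1) N ≫ h N (N - 1) (by simp)) ≫ Y.d (N - 1) N = 0 := by
      rw [hRel_iff f N h (N - 1) (N + 1) (by simp) rfl] at hN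
      rw [Preadditive.sub_comp, f.comm, hN]
      simp
    have := hX (N - 1)
    obtain ⟨c, hc⟩ : ∃ c : X.X (N - 1) ⟶ Y.X (N - 2), c ≫ Y.d (N - 2) (N - 1) =
        f.f (N - 1) - X.d (N - 1) N ≫ h N (N - 1) (by simp) :=
      ⟨hex.liftFromProjective _ hz, hex.liftFromProjective_comp _ hz⟩
    refine ⟨fun q hq => c ≫ eqToHom (by congr 1; lia), ?_⟩
    rw [hRel_iff _ _ _ (N - 2) N (by ring) (by ring)]
    rw [Function.update_self, Function.update_of_ne (by lia)]
    simp [hc]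

lemma isKProjective_of_highContr {A : Type*} [Category* A] [Abelian A]
    {X : CochainComplex A ℤ}
    (hX : ∀ i, Projective (X.X i)) (hc : HighContr X) : X.IsKProjective :=
  ⟨fun f hL => homotopy_zero_of_highContr f hX hc hL⟩

end Homotopy

section Cone

variable {A : Type*} [Category* A] [Abelian A]

open CochainComplex

/-- Partial contraction of a mapping cone. -/
def coneContr {X Y : CochainComplex A ℤ} (φ : X ⟶ Y) (p : ℤ) :
    HFam (mappingCone φ) (mappingCone φ) p := fun q hq =>
  open Classical in
  if h : IsIso (φ.f p) then
    (mappingCone.snd φ).v p p (by simp) ≫ inv (φ.f p) ≫ (mappingCone.inl φ).v p q (by lia)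
  else 0

lemma coneContr_rel {X Y : CochainComplex A ℤ} (φ : X ⟶ Y) (p : ℤ) [IsIso (φ.f p)]
    [IsIso (φ.f (p + 1))] : HRel (𝟙 (mappingCone φ)) p (coneContr φ) := by
  unfold HRel coneContr
  rw [dif_pos (inferInstanceAs (IsIso (φ.f p))), dif_pos (inferInstanceAs (IsIso (φ.f (p + 1)))), mappingCone.ext_from_iff φ (p + 1) p rfl]
  constructor
  · rw [mappingCone.ext_to_iff φ p (p + 1) rfl]
    constructor
    · simp [mappingCone.inl_v_d_assoc φ (p + 1) p (p + 2) (by ring) (by ring)]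
    · simp [mappingCone.inl_v_d_assoc φ (p + 1) p (p + 2) (by ring) (by ring)]
  · rw [mappingCone.ext_to_iff φ p (p + 1) rfl]
    constructor
    · have : inv (φ.f p) ≫ X.d p (p + 1) = Y.d p (p + 1) ≫ inv (φ.f (p + 1)) := by
        rw [IsIso.inv_comp_eq, ← Category.assoc, IsIso.eq_comp_inv, φ.comm]
      simp [this]
    · simp

lemma lowContr_cone {X Y : CochainComplex A ℤ} (φ : X ⟶ Y) (m : ℤ)
    (h : ∀ p ≤ m, IsIso (φ.f p)) : LowContr (mappingCone φ) :=
  ⟨m - 1, coneContr φ, fun p hp => by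
    have := h p (by lia)
    have := h (p + 1) (by lia)
    exact coneContr_rel φ p⟩

lemma highContr_cone {X Y : CochainComplex A ℤ} (φ : X ⟶ Y) (m : ℤ)
    (h : ∀ p, m ≤ p → IsIso (φ.f p)) : HighContr (mappingCone φ) :=
  ⟨m, coneContr φ, fun p hp => by
    have := h p (by lia)
    have := h (p + 1) (by lia)
    exact coneContr_rel φ p⟩

lemma lowContr_of_isZero {Y : CochainComplex A ℤ} (m : ℤ) (h : ∀ p < m, IsZero (Y.X p)) :
    LowContr Y :=
  ⟨m - 1, fun _ _ _ => 0, fun p hp => (h p (by lia)).eq_of_src _ _⟩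

lemma highContr_of_isZero {Y : CochainComplex A ℤ} (m : ℤ) (h : ∀ p, m < p → IsZero (Y.X p)) :
    HighContr Y :=
  ⟨m + 1, fun _ _ _ => 0, fun p hp => (h p (by lia)).eq_of_src _ _⟩

end Cone

end TateDual

namespace TateDual

section PartB

variable {R}

/-- Reindex a `ℤ`-indexed chain complex as a cochain complex. -/
@[simps]
def flip {A : Type*} [Category* A] [HasZeroMorphisms A] (X : ChainComplex A ℤ) :
    CochainComplex A ℤ where
  X i := X.X (-i)
  d i j := X.d (-i) (-j)
  shape i j h := X.shape _ _ (fun h' => h (by simp at h' ⊢; lia))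
  d_comp_d' _ _ _ _ _ := X.d_comp_d _ _ _

/-- `flip` on morphisms. -/
@[simps]
def flipMap {A : Type*} [Category* A] [HasZeroMorphisms A] {X Y : ChainComplex A ℤ}
    (f : X ⟶ Y) : flip X ⟶ flip Y where
  f i := f.f (-i)
  comm' _ _ _ := f.comm _ _

/-- Homology of `flip`. -/
def flipHomologyIso {A : Type*} [Category* A] [Abelian A] (X : ChainComplex A ℤ) (i j : ℤ)
    (h : j = -i) : (flip X).homology i ≅ X.homology j :=
  ShortComplex.homologyMapIso ((flip X).isoSc' (i - 1) i (i + 1) (by simp) (by simp)) ≪≫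
    (ShortComplex.homologyMapIso (X.isoSc' (-(i-1)) (-i) (-(i+1))
      (by simp; lia) (by simp; lia))).symm ≪≫
    eqToIso (by subst h; rfl)

lemma upExactAt_iff (X : CochainComplex (ModuleCat.{u} R) ℤ) (i j k : ℤ) (h1 : i + 1 = j)
    (h2 : j + 1 = k) : X.ExactAt j ↔ ∀ x : X.X j, (X.d j k) x = 0 → ∃ y : X.X i, (X.d i j) y = x := by
  rw [X.exactAt_iff' i j k (by simp; lia) (by simp; lia), ShortComplex.moduleCat_exact_iff]
  rfl

lemma downExactAt_iff (X : ChainComplex (ModuleCat.{u} R) ℤ) (i j k : ℤ) (h1 : j + 1 = i)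
    (h2 : k + 1 = j) : X.ExactAt j ↔ ∀ x : X.X j, (X.d j k) x = 0 → ∃ y : X.X i, (X.d i j) y = x := by
  rw [X.exactAt_iff' i j k (by simp; lia) (by simp; lia), ShortComplex.moduleCat_exact_iff]
  rfl

lemma exists_retract (F : Type u) [AddCommGroup F] [Module R F] [Module.Projective R F]
    [Module.Finite R F] : ∃ (k : ℕ) (s : F →ₗ[R] (Fin k → R)) (p : (Fin k → R) →ₗ[R] F),
      p ∘ₗ s = LinearMap.id := by
  obtain ⟨k, p, hp⟩ := Module.Finite.exists_fin' R F
  obtain ⟨s, hs⟩ := Module.projective_lifting_property p LinearMap.id hp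
  exact ⟨k, s, p, hs⟩

lemma homExactInto_of_ring (X : CochainComplex (ModuleCat.{u} R) ℤ)
    (h : HomExactInto X (ModuleCat.of R R)) (F : ModuleCat.{u} R) [Module.Projective R F]
    [Module.Finite R F] : HomExactInto X F := by
  intro i j k h1 h2 g hg
  obtain ⟨m, s, p, hsp⟩ := exists_retract (R := R) F
  have (a : Fin m) : ∃ c : X.X k ⟶ ModuleCat.of R R, X.d j k ≫ c =
      g ≫ ModuleCat.ofHom (LinearMap.proj a ∘ₗ s) := by
    apply h i j k h1 h2
    rw [← Category.assoc, hg, zero_comp]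
  choose c hc using this
  refine ⟨ModuleCat.ofHom (p ∘ₗ LinearMap.pi (fun a => (c a).hom)), ?_⟩
  ext x
  have h3 (a : Fin m) : c a (X.d j k x) = s (g x) a := by
    have := congr($(hc a) x)
    simpa using this
  have h4 : LinearMap.pi (fun a => (c a).hom) (X.d j k x) = s (g x) := by
    ext a
    exact h3 a
  have h5 : p (s (g x)) = g x := congr($hsp (g x))
  simp only [ModuleCat.hom_comp, ModuleCat.hom_ofHom, LinearMap.comp_apply]
  rw [h4, h5]

lemma homExactInto_shift {A : Type*} [Category* A] [Preadditive A] (X : CochainComplex A ℤ) (F : A)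
    (h : HomExactInto X F) (n : ℤ) : HomExactInto (X⟦n⟧) F := by
  intro i j k h1 h2 g hg
  change X.X (j + n) ⟶ F at g
  change (n.negOnePow • X.d (i + n) (j + n)) ≫ g = 0 at hg
  obtain ⟨c, hc⟩ := h (i + n) (j + n) (k + n) (by lia) (by lia) g (by
    rw [Linear.units_smul_comp] at hg
    have := congr(n.negOnePow • $hg)
    simpa [smul_smul] using this)
  refine ⟨n.negOnePow • c, ?_⟩
  change (n.negOnePow • X.d (j + n) (k + n)) ≫ (n.negOnePow • c) = g
  rw [Linear.units_smul_comp, Linear.comp_units_smul, smul_smul, Int.units_mul_self, one_smul]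
  exact hc

lemma homExactInto_flip (X : ChainComplex (ModuleCat.{u} R) ℤ) (N : ModuleCat.{u} R)
    (h : ∀ i, (X.linearYonedaObj R N).ExactAt i) : HomExactInto (flip X) N := by
  intro i j k h1 h2 g hg
  obtain ⟨c, hc⟩ := (upExactAt_iff _ (-k) (-j) (-i) (by lia) (by lia)).1 (h (-j)) g hg
  exact ⟨c, hc⟩

instance (X : ChainComplex (ModuleCat.{u} R) ℤ) (i : ℤ) [Module.Finite R (X.X i)]
    [Module.Projective R (X.X i)] :
    Module.Finite R ((X.linearYonedaObj R (ModuleCat.of R R)).X i) :=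
  Module.Finite.equiv (ModuleCat.homLinearEquiv (S := R) (M := X.X i) (N := ModuleCat.of R R)).symm

instance (X : ChainComplex (ModuleCat.{u} R) ℤ) (i : ℤ) [Module.Finite R (X.X i)]
    [Module.Projective R (X.X i)] :
    Module.Projective R ((X.linearYonedaObj R (ModuleCat.of R R)).X i) :=
  Module.Projective.of_equiv
    (ModuleCat.homLinearEquiv (S := R) (M := X.X i) (N := ModuleCat.of R R)).symm

lemma homExactInto_dual (X : ChainComplex (ModuleCat.{u} R) ℤ)
    (hp : ∀ i, Module.Projective R (X.X i)) (hf : ∀ i, Module.Finite R (X.X i))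
    (h : ∀ i, X.ExactAt i) :
    HomExactInto (X.linearYonedaObj R (ModuleCat.of R R)) (ModuleCat.of R R) := by
  intro i j k h1 h2 g hg
  let g' : Module.Dual R (Module.Dual R (X.X j)) :=
    (g.hom : _ →ₗ[R] R) ∘ₗ (ModuleCat.homLinearEquiv (S := R) (M := X.X j) (N := ModuleCat.of R R)).symm.toLinearMap
  obtain ⟨t, ht⟩ := (Module.bijective_dual_eval R (X.X j)).2 g'
  have ht' (f : X.X j ⟶ ModuleCat.of R R) : g.hom f = f.hom t := by
    have := congr($ht f.hom)
    exact this.symm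
  have hdt : X.d j i t = 0 := by
    apply (Module.bijective_dual_eval R (X.X i)).1
    rw [map_zero]
    ext f
    have h3 := congr($hg (ModuleCat.ofHom f))
    have h4 := ht' (X.d j i ≫ ModuleCat.ofHom f)
    have h5 : g.hom (X.d j i ≫ ModuleCat.ofHom f) = 0 := h3
    rw [h4] at h5
    exact h5
  obtain ⟨t', ht2⟩ := (downExactAt_iff X k j i (by lia) (by lia)).1 (h j) t hdt
  refine ⟨ModuleCat.ofHom ((Module.Dual.eval R (X.X k) t') ∘ₗ
    (ModuleCat.homLinearEquiv (S := R) (M := X.X k) (N := ModuleCat.of R R)).toLinearMap), ?_⟩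
  ext f
  refine Eq.trans ?_ (ht' f).symm
  rw [← ht2]
  rfl

end PartB

end TateDual

namespace TateDual

section PartF

open Pretriangulated

lemma comp_mor₁_bijective {T : Type*} [Category* T] [Preadditive T] [HasZeroObject T]
    [HasShift T ℤ] [∀ n : ℤ, (shiftFunctor T n).Additive] [Pretriangulated T]
    (Δ : Triangle T) (hΔ : Δ ∈ distTriang T) (X : T)
    (h0 : ∀ f : X ⟶ Δ.obj₃, f = 0) (h1 : ∀ f : X⟦(1 : ℤ)⟧ ⟶ Δ.obj₃, f = 0) :
    Function.Bijective (fun f : X ⟶ Δ.obj₁ => f ≫ Δ.mor₁) := by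
  constructor
  · refine (injective_iff_map_eq_zero ((Preadditive.rightComp X Δ.mor₁ : (X ⟶ Δ.obj₁) →+ _))).2 ?_
    intro f hf
    change f ≫ Δ.mor₁ = 0 at hf
    have : f⟦(1 : ℤ)⟧' ≫ Δ.mor₁⟦(1 : ℤ)⟧' = 0 := by
      rw [← Functor.map_comp, hf, Functor.map_zero]
    obtain ⟨g, hg⟩ := Triangle.coyoneda_exact₁ Δ hΔ (f⟦(1 : ℤ)⟧') this
    rw [h1 g, zero_comp] at hg
    exact (shiftFunctor T (1 : ℤ)).map_injective (by rw [hg, Functor.map_zero])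
  · intro f
    obtain ⟨g, hg⟩ := Triangle.coyoneda_exact₂ Δ hΔ f (h0 _)
    exact ⟨g, hg.symm⟩

lemma iso_of_bijective {T : Type*} [Category* T] {U Q W B : T} (a : U ⟶ Q) (b : W ⟶ B) (e : Q ≅ B)
    (hUa : Function.Bijective (fun f : U ⟶ U => f ≫ a))
    (hWa : Function.Bijective (fun f : W ⟶ U => f ≫ a))
    (hUb : Function.Bijective (fun f : U ⟶ W => f ≫ b))
    (hWb : Function.Bijective (fun f : W ⟶ W => f ≫ b)) : Nonempty (U ≅ W) := by
  obtain ⟨f, hf⟩ := hUb.2 (a ≫ e.hom)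
  obtain ⟨g, hg⟩ := hWa.2 (b ≫ e.inv)
  dsimp at hf hg
  refine ⟨⟨f, g, hUa.1 ?_, hWb.1 ?_⟩⟩
  · simp [hg, reassoc_of% hf]
  · simp [hf, reassoc_of% hg]

variable {A : Type*} [Category* A] [Abelian A]

variable (A) in
/-- The quotient functor to the homotopy category. -/
abbrev qq := HomotopyCategory.quotient A (ComplexShape.up ℤ)

lemma quotient_hom_zero (X Z : CochainComplex A ℤ) (hX : ∀ i, HomExactInto X (Z.X i))
    (hZ : LowContr Z) (f : (qq A).obj X ⟶ (qq A).obj Z) : f = 0 := by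
  obtain ⟨f, rfl⟩ := (qq A).map_surjective f
  obtain ⟨h⟩ := homotopy_zero_of_lowContr f hX hZ
  rw [HomotopyCategory.eq_of_homotopy _ _ h, Functor.map_zero]

lemma quotient_hom_zero' (X Z : CochainComplex A ℤ) (hX : ∀ i, HomExactInto X (Z.X i))
    (hZ : LowContr Z) (f : ((qq A).obj X)⟦(1 : ℤ)⟧ ⟶ (qq A).obj Z) : f = 0 := by
  have := quotient_hom_zero (X⟦(1 : ℤ)⟧) Z (fun i => homExactInto_shift X _ (hX i) 1) hZ
    (((qq A).commShiftIso (1 : ℤ)).hom.app X ≫ f)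
  rw [← cancel_epi (((qq A).commShiftIso (1 : ℤ)).hom.app X), this, comp_zero]

lemma comp_bijective₁ {V U : CochainComplex A ℤ} (φ : V ⟶ U) (X : CochainComplex A ℤ)
    (hX : ∀ i, HomExactInto X ((CochainComplex.mappingCone φ).X i))
    (hZ : LowContr (CochainComplex.mappingCone φ)) :
    Function.Bijective (fun f : (qq A).obj X ⟶ (qq A).obj V => f ≫ (qq A).map φ) :=
  comp_mor₁_bijective _ (HomotopyCategory.mappingCone_triangleh_distinguished φ) _
    (quotient_hom_zero X _ hX hZ) (quotient_hom_zero' X _ hX hZ)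

lemma comp_bijective₂ {V U : CochainComplex A ℤ} (φ : V ⟶ U) (X : CochainComplex A ℤ)
    (hX : ∀ i, HomExactInto X (V.X i)) (m : ℤ) (hZ : ∀ p < m, IsZero (V.X p)) :
    Function.Bijective (fun f : (qq A).obj X ⟶ (qq A).obj U =>
      f ≫ (qq A).map (CochainComplex.mappingCone.inr φ)) := by
  have hX' : ∀ i, HomExactInto X ((V⟦(1 : ℤ)⟧).X i) := fun i => hX _
  have hZ' : LowContr (V⟦(1 : ℤ)⟧) :=
    lowContr_of_isZero (m - 1) (fun p hp => hZ (p + 1) (by lia))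
  refine comp_mor₁_bijective _
    (rot_of_distTriang _ (HomotopyCategory.mappingCone_triangleh_distinguished φ)) _ ?_ ?_
  · intro f
    have := quotient_hom_zero X _ hX' hZ' (f ≫ ((qq A).commShiftIso (1 : ℤ)).inv.app V)
    exact (cancel_mono (((qq A).commShiftIso (1 : ℤ)).inv.app V)).1 (this.trans zero_comp.symm)
  · intro f
    have := quotient_hom_zero' X _ hX' hZ' (f ≫ ((qq A).commShiftIso (1 : ℤ)).inv.app V)
    exact (cancel_mono (((qq A).commShiftIso (1 : ℤ)).inv.app V)).1 (this.trans zero_comp.symm)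

lemma homotopyEquiv_of_cones {V U W B : CochainComplex A ℤ} (φ : V ⟶ U) (θ : W ⟶ B)
    (e : (qq A).obj (CochainComplex.mappingCone φ) ≅ (qq A).obj B)
    (hUV : ∀ i, HomExactInto U (V.X i)) (hWV : ∀ i, HomExactInto W (V.X i))
    (hUC : ∀ i, HomExactInto U ((CochainComplex.mappingCone θ).X i))
    (hWC : ∀ i, HomExactInto W ((CochainComplex.mappingCone θ).X i))
    (m : ℤ) (hV : ∀ p < m, IsZero (V.X p))
    (m' : ℤ) (hθ : ∀ p ≤ m', IsIso (θ.f p)) :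
    Nonempty (HomotopyEquiv U W) := by
  have hc := lowContr_cone θ m' hθ
  obtain ⟨i⟩ := iso_of_bijective _ _ e (comp_bijective₂ φ U hUV m hV) (comp_bijective₂ φ W hWV m hV)
    (comp_bijective₁ θ U hUC hc) (comp_bijective₁ θ W hWC hc)
  exact ⟨HomotopyCategory.homotopyEquivOfIso i⟩

end PartF

end TateDual

namespace TateDual

section PartG

open Pretriangulated DerivedCategory ZeroObject

variable {A : Type*} [Category* A] [Abelian A]

attribute [local instance] HasDerivedCategory.standard

lemma quotient_iso_of_Q_iso (K L : CochainComplex A ℤ) [K.IsKProjective] [L.IsKProjective]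
    (e : DerivedCategory.Q.obj K ≅ DerivedCategory.Q.obj L) :
    Nonempty ((qq A).obj K ≅ (qq A).obj L) := by
  obtain ⟨f, hf⟩ := (CochainComplex.IsKProjective.Qh_map_bijective K ((qq A).obj L)).surjective
    ((quotientCompQhIso A).hom.app K ≫ e.hom ≫ (quotientCompQhIso A).inv.app L)
  obtain ⟨g, hg⟩ := (CochainComplex.IsKProjective.Qh_map_bijective L ((qq A).obj K)).surjective
    ((quotientCompQhIso A).hom.app L ≫ e.inv ≫ (quotientCompQhIso A).inv.app K)
  refine ⟨⟨f, g, (CochainComplex.IsKProjective.Qh_map_bijective _ _).injective ?_,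
    (CochainComplex.IsKProjective.Qh_map_bijective _ _).injective ?_⟩⟩
  · simp [hf, hg]
  · simp [hf, hg]

lemma exists_Q_iso_single (K : CochainComplex A ℤ) (m : ℤ) (hK : ∀ i, i ≠ m → K.ExactAt i) :
    Nonempty (DerivedCategory.Q.obj K ≅ (singleFunctor A m).obj (K.homology m)) := by
  have h1 : (DerivedCategory.Q.obj K).IsGE m := by
    rw [isGE_Q_obj_iff, CochainComplex.isGE_iff]
    exact fun i hi => hK i (by lia)
  have h2 : (DerivedCategory.Q.obj K).IsLE m := by
    rw [isLE_Q_obj_iff, CochainComplex.isLE_iff]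
    exact fun i hi => hK i (by lia)
  obtain ⟨Y, ⟨e⟩⟩ := exists_iso_singleFunctor_obj_of_isGE_of_isLE (DerivedCategory.Q.obj K) m
  have e1 : K.homology m ≅ Y :=
    ((homologyFunctorFactors A m).app K).symm ≪≫
      (DerivedCategory.homologyFunctor A m).mapIso (e ≪≫ (singleFunctorIsoCompQ A m).app Y) ≪≫
      (homologyFunctorFactors A m).app _ ≪≫
      (HomologicalComplex.homologyFunctorSingleIso A (ComplexShape.up ℤ) m).app Y
  exact ⟨e ≪≫ (singleFunctor A m).mapIso e1.symm⟩

lemma Q_iso_of_homology (K L : CochainComplex A ℤ) (m : ℤ) (hK : ∀ i, i ≠ m → K.ExactAt i)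
    (hL : ∀ i, i ≠ m → L.ExactAt i) (e : K.homology m ≅ L.homology m) :
    Nonempty (DerivedCategory.Q.obj K ≅ DerivedCategory.Q.obj L) := by
  obtain ⟨e1⟩ := exists_Q_iso_single K m hK
  obtain ⟨e2⟩ := exists_Q_iso_single L m hL
  exact ⟨e1 ≪≫ (singleFunctor A m).mapIso e ≪≫ e2.symm⟩

lemma Q_isZero (U : CochainComplex A ℤ) (hU : ∀ i, U.ExactAt i) :
    IsZero (DerivedCategory.Q.obj U) := by
  have : QuasiIso (0 : U ⟶ 0) := ⟨fun i => by
    rw [quasiIsoAt_iff_exactAt']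
    · exact hU i
    · exact ShortComplex.exact_of_isZero_X₂ _
        ((HomologicalComplex.eval A (ComplexShape.up ℤ) i).map_isZero (isZero_zero _))⟩
  exact (DerivedCategory.Q.map_isZero (isZero_zero (CochainComplex A ℤ))).of_iso
    (asIso (DerivedCategory.Q.map (0 : U ⟶ 0)))

lemma Q_cone_iso {V U : CochainComplex A ℤ} (φ : V ⟶ U) (hU : ∀ i, U.ExactAt i) :
    Nonempty (DerivedCategory.Q.obj (CochainComplex.mappingCone φ) ≅
      DerivedCategory.Q.obj (V⟦(1 : ℤ)⟧)) := by
  have h := (Triangle.isZero₂_iff_isIso₃ _ (mappingCone_triangle_distinguished φ)).1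
    (Q_isZero U hU)
  exact ⟨(@asIso _ _ _ _ _ h) ≪≫ ((DerivedCategory.Q.commShiftIso (1 : ℤ)).app V).symm⟩

lemma shift_exactAt (K : CochainComplex A ℤ) (n i : ℤ) (h : K.ExactAt (n + i)) :
    (K⟦n⟧).ExactAt i := by
  rw [HomologicalComplex.exactAt_iff_isZero_homology] at h ⊢
  exact h.of_iso ((CochainComplex.ShiftSequence.shiftIso A n i (n + i) rfl).app K)

lemma quotient_cone_iso {V U B : CochainComplex A ℤ} (φ : V ⟶ U) (hU : ∀ i, U.ExactAt i)
    (m : ℤ) (hV : ∀ i, i ≠ m + 1 → V.ExactAt i) (hB : ∀ i, i ≠ m → B.ExactAt i)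
    (e : V.homology (m + 1) ≅ B.homology m)
    (pQ : ∀ i, Projective ((CochainComplex.mappingCone φ).X i)) (pB : ∀ i, Projective (B.X i))
    (m' : ℤ) (hφ : ∀ p, m' ≤ p → IsIso (φ.f p))
    (m'' : ℤ) (hB' : ∀ p, m'' < p → IsZero (B.X p)) :
    Nonempty ((qq A).obj (CochainComplex.mappingCone φ) ≅ (qq A).obj B) := by
  have := isKProjective_of_highContr pQ (highContr_cone φ m' hφ)
  have := isKProjective_of_highContr pB (highContr_of_isZero m'' hB')
  obtain ⟨e1⟩ := Q_cone_iso φ hU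
  obtain ⟨e2⟩ := Q_iso_of_homology (V⟦(1 : ℤ)⟧) B m
    (fun i hi => shift_exactAt _ _ _ (hV _ (by lia))) hB
    ((CochainComplex.ShiftSequence.shiftIso A 1 m (m + 1) (by lia)).app V ≪≫ e)
  exact quotient_iso_of_Q_iso _ _ (e1 ≪≫ e2)

end PartG

end TateDual

namespace TateDual

section PartH

variable {R}

/-- The nonnegative part of a chain complex. -/
@[simps]
def natPart {A : Type*} [Category* A] [HasZeroMorphisms A] (X : ChainComplex A ℤ) :
    ChainComplex A ℕ where
  X i := X.X i
  d i j := X.d i j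
  shape i j h := X.shape _ _ (fun h' => h (by simp at h' ⊢; lia))
  d_comp_d' _ _ _ _ _ := X.d_comp_d _ _ _

/-- The projective resolution attached to a complete resolution. -/
def projRes {M : ModuleCat.{u} R} (C : CompleteResolution R M) : ProjectiveResolution M where
  complex := natPart C.P
  projective n := C.projP n
  π := (ChainComplex.toSingle₀Equiv _ _).symm ⟨C.π, C.wπ⟩
  quasiIso := ⟨fun n => by
    cases n with
    | zero =>
      rw [ChainComplex.quasiIsoAt₀_iff, ShortComplex.quasiIso_iff_of_zeros']
      · refine (ShortComplex.exact_and_epi_g_iff_of_iso ?_).2 ⟨C.exact0, C.epiπ⟩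
        exact ShortComplex.isoMk (Iso.refl _) (Iso.refl _) (Iso.refl _)
          (by simp; rfl) (by simp; rfl)
      · exact C.P.shape _ _ (by simp)
      all_goals rfl
    | succ n =>
      rw [quasiIsoAt_iff_exactAt']
      · have := C.exactP (n + 1 : ℕ) (by lia)
        rw [C.P.exactAt_iff' ((n + 2 : ℕ) : ℤ) ((n + 1 : ℕ) : ℤ) (n : ℤ)
          (by simp; lia) (by simp)] at this
        rw [(natPart C.P).exactAt_iff' (n + 2) (n + 1) n (by simp) (by simp)]
        exact this
      · apply ChainComplex.exactAt_succ_single_obj⟩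

lemma homology_linearYoneda {M : ModuleCat.{u} R} (C : CompleteResolution R M)
    (Y : ModuleCat.{u} R) (k : ℕ) :
    Nonempty ((C.P.linearYonedaObj R Y).homology (k : ℤ) ≅
      ((natPart C.P).linearYonedaObj R Y).homology k) := by
  cases k with
  | zero =>
    let S1 := ((natPart C.P).linearYonedaObj R Y).sc' 0 0 1
    let S2 := (C.P.linearYonedaObj R Y).sc' (-1) 0 1
    have hz : IsZero S2.X₁ := by
      rw [IsZero.iff_id_eq_zero]
      ext (x : C.P.X (-1) ⟶ Y)
      obtain rfl : x = 0 := (C.zeroP (-1) (by lia)).eq_of_src _ _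
      rfl
    have hf : S1.f = 0 := ((natPart C.P).linearYonedaObj R Y).shape _ _ (by simp)
    let φ : S1 ⟶ S2 :=
      { τ₁ := 0
        τ₂ := 𝟙 (C.P.linearYonedaObj R Y).X 0
        τ₃ := 𝟙 ((C.P.linearYonedaObj R Y).X 1)
        comm₁₂ := by
          rw [hf]
          exact zero_comp.trans zero_comp.symm
        comm₂₃ := by
          exact (Category.id_comp _).trans (Category.comp_id _).symm }
    have : Epi φ.τ₁ := ⟨fun _ _ _ => hz.eq_of_src _ _⟩
    have : IsIso φ.τ₂ := inferInstanceAs (IsIso (𝟙 _))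
    have : Mono φ.τ₃ := inferInstanceAs (Mono (𝟙 _))
    have := ShortComplex.quasiIso_of_epi_of_isIso_of_mono φ
    exact ⟨ShortComplex.homologyMapIso ((C.P.linearYonedaObj R Y).isoSc' (-1) 0 1
        (by simp) (by simp)) ≪≫
      (asIso (ShortComplex.homologyMap φ)).symm ≪≫
      (ShortComplex.homologyMapIso (((natPart C.P).linearYonedaObj R Y).isoSc' 0 0 1
        (by simp) (by simp))).symm⟩
  | succ k =>
    exact ⟨ShortComplex.homologyMapIso ((C.P.linearYonedaObj R Y).isoSc' (k : ℤ) ((k + 1 : ℕ) : ℤ)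
        ((k + 2 : ℕ) : ℤ) (by simp) (by simp; lia)) ≪≫
      (ShortComplex.homologyMapIso (((natPart C.P).linearYonedaObj R Y).isoSc' k (k + 1) (k + 2)
        (by simp) (by simp))).symm⟩

lemma homology_ext {M : ModuleCat.{u} R} (C : CompleteResolution R M)
    (Y : ModuleCat.{u} R) (k : ℕ) :
    Nonempty ((C.P.linearYonedaObj R Y).homology (k : ℤ) ≅ ExtMod R k M Y) := by
  obtain ⟨e⟩ := homology_linearYoneda C Y k
  exact ⟨e ≪≫ ((projRes C).isoExt k Y).symm⟩

lemma linearYoneda_isZero {M : ModuleCat.{u} R} (C : CompleteResolution R M)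
    (Y : ModuleCat.{u} R) (i : ℤ) (hi : i < 0) : IsZero ((C.P.linearYonedaObj R Y).X i) := by
  rw [IsZero.iff_id_eq_zero]
  ext (x : C.P.X i ⟶ Y)
  obtain rfl : x = 0 := (C.zeroP i hi).eq_of_src _ _
  rfl

lemma linearYoneda_exactAt {M : ModuleCat.{u} R} (C : CompleteResolution R M)
    (Y : ModuleCat.{u} R) (n : ℕ) (h : ∀ i : ℕ, i ≠ n → IsZero (ExtMod R i M Y))
    (i : ℤ) (hi : i ≠ n) : (C.P.linearYonedaObj R Y).ExactAt i := by
  obtain hi' | hi' := lt_or_ge i 0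
  · exact ShortComplex.exact_of_isZero_X₂ _ (linearYoneda_isZero C Y i hi')
  · obtain ⟨k, rfl⟩ := Int.eq_ofNat_of_zero_le hi'
    rw [HomologicalComplex.exactAt_iff_isZero_homology]
    obtain ⟨e⟩ := homology_ext C Y k
    exact (h k (by lia)).of_iso e

lemma homology_P {M : ModuleCat.{u} R} (C : CompleteResolution R M) :
    Nonempty (C.P.homology 0 ≅ M) := by
  let S := C.P.sc' 1 0 (-1)
  have hg : S.g = 0 := (C.zeroP (-1) (by lia)).eq_of_tgt _ _
  have := C.epiπ
  let h : S.RightHomologyData :=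
    { Q := M
      H := M
      p := C.π
      ι := 𝟙 M
      wp := C.wπ
      hp := C.exact0.gIsCokernel
      wι := by
        refine (C.zeroP (-1) (by lia)).eq_of_tgt _ _
      hι := KernelFork.IsLimit.ofId _ ((C.zeroP (-1) (by lia)).eq_of_tgt _ _) }
  exact ⟨ShortComplex.homologyMapIso (C.P.isoSc' 1 0 (-1) (by simp) (by simp)) ≪≫ h.homologyIso⟩

end PartH

end TateDual

namespace TateDual

section PartJ

lemma ses_of_complex {A : Type*} [Category* A] [Abelian A] (G : ChainComplex A ℕ) (k : ℕ) (Z : A)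
    (p : G.X k ⟶ Z) [Epi p] (w : G.d (k + 1) k ≫ p = 0)
    (hp : (ShortComplex.mk _ _ w).Exact) (h : G.ExactAt (k + 1)) :
    ∃ w', (ShortComplex.mk (cokernel.desc (G.d (k + 2) (k + 1)) (G.d (k + 1) k)
      (G.d_comp_d _ _ _)) p w').ShortExact := by
  have w' : cokernel.desc (G.d (k + 2) (k + 1)) (G.d (k + 1) k) (G.d_comp_d _ _ _) ≫ p = 0 := by
    rw [← cancel_epi (cokernel.π _)]
    simpa using w
  refine ⟨w', ?_⟩
  rw [G.exactAt_iff' (k + 2) (k + 1) k (by simp) (by simp)] at h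
  have hm : Mono (cokernel.desc (G.d (k + 2) (k + 1)) (G.d (k + 1) k) (G.d_comp_d _ _ _)) :=
    (ShortComplex.exact_iff_mono_cokernel_desc _).1 h
  let φ : ShortComplex.mk _ _ w ⟶ ShortComplex.mk _ _ w' :=
    { τ₁ := cokernel.π _
      τ₂ := 𝟙 _
      τ₃ := 𝟙 _ }
  have : Epi φ.τ₁ := inferInstanceAs (Epi (cokernel.π _))
  have : IsIso φ.τ₂ := inferInstanceAs (IsIso (𝟙 _))
  have : Mono φ.τ₃ := inferInstanceAs (Mono (𝟙 _))
  exact { exact := (ShortComplex.exact_iff_of_epi_of_isIso_of_mono φ).1 hp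
          mono_f := hm
          epi_g := inferInstanceAs (Epi p) }

lemma subsingleton_ext_of_ses {A : Type*} [Category* A] [Abelian A] [HasExt A]
    {S : ShortComplex A} (hS : S.ShortExact) (Y : A) (i : ℕ)
    (h1 : Subsingleton (Abelian.Ext S.X₁ Y i)) (h2 : Subsingleton (Abelian.Ext S.X₂ Y (i + 1))) :
    Subsingleton (Abelian.Ext S.X₃ Y (i + 1)) := by
  refine subsingleton_of_forall_eq 0 fun x => ?_
  obtain ⟨y, hy⟩ := Abelian.Ext.contravariant_sequence_exact₃ hS (Y := Y) x
    (Subsingleton.elim _ _) (n₀ := i) (by lia)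
  rw [← hy, Subsingleton.elim y 0, Abelian.Ext.comp_zero]

lemma subsingleton_ext_of_isZero {A : Type*} [Category* A] [Abelian A] [HasExt A]
    (X Y : A) (hX : IsZero X) (i : ℕ) : Subsingleton (Abelian.Ext X Y i) := by
  refine subsingleton_of_forall_eq 0 fun x => ?_
  rw [← Abelian.Ext.mk₀_id_comp x, hX.eq_of_src (𝟙 X) 0, Abelian.Ext.mk₀_zero,
    Abelian.Ext.zero_comp]

lemma subsingleton_ext_of_resolution {A : Type*} [Category* A] [Abelian A] [HasExt A]
    (G : ChainComplex A ℕ) (n : ℕ) (Y M : A) (ε : G.X 0 ⟶ M) [Epi ε] (w : G.d 1 0 ≫ ε = 0)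
    (hε : (ShortComplex.mk _ _ w).Exact) (hG : ∀ i, 0 < i → G.ExactAt i)
    (hz : ∀ i, n < i → IsZero (G.X i))
    (hY : ∀ k i, Subsingleton (Abelian.Ext (G.X k) Y (i + 1))) (i : ℕ) (hi : n < i) :
    Subsingleton (Abelian.Ext M Y i) := by
  have key (j : ℕ) : ∀ k, k + j = n + 1 → ∀ i, n + 1 ≤ i + k →
      Subsingleton (Abelian.Ext (cokernel (G.d (k + 1) k)) Y i) := by
    induction j with
    | zero =>
      intro k hk i hi
      apply subsingleton_ext_of_isZero
      exact IsZero.of_epi (cokernel.π (G.d (k + 1) k)) (hz k (by lia))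
    | succ j ih =>
      intro k hk i hi
      obtain ⟨i, rfl⟩ : ∃ i', i = i' + 1 := ⟨i - 1, by lia⟩
      obtain ⟨w', hs⟩ := ses_of_complex G k _ (cokernel.π (G.d (k + 1) k)) (cokernel.condition _)
        (ShortComplex.exact_cokernel _) (hG _ (by lia))
      exact subsingleton_ext_of_ses hs Y i (ih (k + 1) (by lia) i (by lia)) (hY k i)
  obtain ⟨i, rfl⟩ : ∃ i', i = i' + 1 := ⟨i - 1, by lia⟩
  obtain ⟨w', hs⟩ := ses_of_complex G 0 _ ε w hε (hG _ (by lia))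
  exact subsingleton_ext_of_ses hs Y i (key n 1 (by lia) i (by lia)) (hY 0 i)

variable {R}

lemma isZero_extMod_iff (X Y : ModuleCat.{u} R) (k : ℕ) :
    IsZero (ExtMod R (k + 1) X Y) ↔ Subsingleton (Abelian.Ext.{u} X Y (k + 1)) := by
  let P := ProjectiveResolution.of X
  rw [(P.isoExt (R := R) (k + 1) Y).isZero_iff,
    ← HomologicalComplex.exactAt_iff_isZero_homology,
    HomologicalComplex.exactAt_iff' _ k (k + 1) (k + 2) (by simp) (by simp),
    ShortComplex.moduleCat_exact_iff]
  constructor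
  · intro h
    refine subsingleton_of_forall_eq 0 fun x => ?_
    obtain ⟨f, hf, rfl⟩ := P.extMk_surjective x (k + 2) (by lia)
    rw [P.extMk_eq_zero_iff _ _ _ _ k (by lia)]
    exact h f hf
  · intro h f hf
    exact (P.extMk_eq_zero_iff (Y := Y) f (k + 2) (by lia) hf k (by lia)).1 (Subsingleton.elim _ _)

lemma isZero_ext_of_gDimLE (M : ModuleCat.{u} R) (n : ℕ) (h : GDimLE R M n) (i : ℕ) (hi : n < i) :
    IsZero (ExtMod R i M (ModuleCat.of R R)) := by
  obtain ⟨G, ε, h1, h2, h3, ⟨w, h4⟩, h5⟩ := h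
  obtain ⟨i, rfl⟩ : ∃ i', i = i' + 1 := ⟨i - 1, by lia⟩
  rw [isZero_extMod_iff]
  refine subsingleton_ext_of_resolution G n _ M ε w h4 h5 h2 ?_ _ hi
  intro k i
  obtain hk | hk := le_or_gt k n
  · rw [← isZero_extMod_iff]
    exact (h1 k hk).2.2.1 _ (by lia)
  · exact subsingleton_ext_of_isZero _ _ (h2 k hk) _

lemma isZero_ext_of_perfect (M : ModuleCat.{u} R) (n : ℕ) (hp : IsGPerfect R M)
    (hn : gdim R M = (n : ℕ∞)) (i : ℕ) (hi : i ≠ n) :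
    IsZero (ExtMod R i M (ModuleCat.of R R)) := by
  obtain hi' | hi' := lt_or_gt_of_ne hi
  · by_contra hc
    have h1 : gradeM R M ≤ (i : ℕ∞) := sInf_le ⟨i, rfl, hc⟩
    rw [show gradeM R M = _ from hp, hn] at h1
    norm_cast at h1
    lia
  · have hne : {c : ℕ∞ | ∃ n : ℕ, c = n ∧ GDimLE R M n}.Nonempty := by
      by_contra hc
      rw [Set.not_nonempty_iff_eq_empty] at hc
      rw [gdim, hc, sInf_empty] at hn
      exact ENat.top_ne_natCast n hn
    obtain ⟨m, hm, hg⟩ := csInf_mem hne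
    rw [show sInf {c : ℕ∞ | ∃ n : ℕ, c = n ∧ GDimLE R M n} = _ from hn] at hm
    norm_cast at hm
    subst hm
    exact isZero_ext_of_gDimLE M _ hg i hi'

end PartJ

end TateDual

namespace TateDual

section PartK

lemma homExactInto_cone {A : Type*} [Category* A] [Abelian A] (X : CochainComplex A ℤ)
    {V U : CochainComplex A ℤ} (φ : V ⟶ U) (hV : ∀ i, HomExactInto X (V.X i))
    (hU : ∀ i, HomExactInto X (U.X i)) (p : ℤ) :
    HomExactInto X ((CochainComplex.mappingCone φ).X p) := by
  intro i j k h1 h2 g hg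
  obtain ⟨c1, hc1⟩ := hV (p + 1) i j k h1 h2
    (g ≫ (CochainComplex.mappingCone.fst φ).1.v p (p + 1) rfl) (by rw [reassoc_of% hg, zero_comp])
  obtain ⟨c2, hc2⟩ := hU p i j k h1 h2
    (g ≫ (CochainComplex.mappingCone.snd φ).v p p (by lia)) (by rw [reassoc_of% hg, zero_comp])
  refine ⟨c1 ≫ (CochainComplex.mappingCone.inl φ).v (p + 1) p (by lia) +
    c2 ≫ (CochainComplex.mappingCone.inr φ).f p, ?_⟩
  rw [Preadditive.comp_add, reassoc_of% hc1, reassoc_of% hc2, ← Preadditive.comp_add,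
    CochainComplex.mappingCone.id_X, Category.comp_id]

lemma projective_cone {A : Type*} [Category* A] [Abelian A]
    {V U : CochainComplex A ℤ} (φ : V ⟶ U) (hV : ∀ i, Projective (V.X i))
    (hU : ∀ i, Projective (U.X i)) (p : ℤ) :
    Projective ((CochainComplex.mappingCone φ).X p) := by
  have := hV (p + 1)
  have := hU p
  let r : Retract ((CochainComplex.mappingCone φ).X p) (V.X (p + 1) ⊞ U.X p) :=
    { i := biprod.lift ((CochainComplex.mappingCone.fst φ).1.v p (p + 1) rfl)
        ((CochainComplex.mappingCone.snd φ).v p p (by lia))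
      r := biprod.desc ((CochainComplex.mappingCone.inl φ).v (p + 1) p (by lia))
        ((CochainComplex.mappingCone.inr φ).f p)
      retract := by rw [biprod.lift_desc, CochainComplex.mappingCone.id_X] }
  exact r.projective

variable {R}

/-- Functoriality of `linearYonedaObj` in the complex. -/
def yMap {X Y : ChainComplex (ModuleCat.{u} R) ℤ} (f : X ⟶ Y) (N : ModuleCat.{u} R) :
    Y.linearYonedaObj R N ⟶ X.linearYonedaObj R N where
  f i := ((linearYoneda R (ModuleCat.{u} R)).obj N).map (f.f i).op
  comm' i j _ := by
    ext (x : Y.X i ⟶ N)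
    change X.d j i ≫ f.f i ≫ x = f.f j ≫ Y.d j i ≫ x
    simp

lemma yMap_isIso {X Y : ChainComplex (ModuleCat.{u} R) ℤ} (f : X ⟶ Y) (N : ModuleCat.{u} R) (i : ℤ)
    [IsIso (f.f i)] : IsIso ((yMap f N).f i) :=
  inferInstanceAs (IsIso (((linearYoneda R (ModuleCat.{u} R)).obj N).map (f.f i).op))

lemma main_homotopyEquiv {M : ModuleCat.{u} R} (n : ℕ)
    (hM : ∀ i : ℕ, i ≠ n → IsZero (ExtMod R i M (ModuleCat.of R R)))
    (C : CompleteResolution R M)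
    (Cd : CompleteResolution R (ExtMod R n M (ModuleCat.of R R))) :
    Nonempty (HomotopyEquiv (C.T.linearYonedaObj R (ModuleCat.of R R))
      ((flip Cd.T)⟦(1 - n : ℤ)⟧)) := by
  have pCT (i) : Module.Projective R (C.T.X i) := (IsProjective.iff_projective _).2 (C.projT i)
  have pCP (i) : Module.Projective R (C.P.X i) := (IsProjective.iff_projective _).2 (C.projP i)
  have pDT (i) : Module.Projective R (Cd.T.X i) := (IsProjective.iff_projective _).2 (Cd.projT i)
  have pDP (i) : Module.Projective R (Cd.P.X i) := (IsProjective.iff_projective _).2 (Cd.projP i)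
  have fCT := C.fgT
  have fCP := C.fgP
  have fDT := Cd.fgT
  have fDP := Cd.fgP
  obtain ⟨m1, hm1⟩ := C.iso_eventually
  obtain ⟨m2, hm2⟩ := Cd.iso_eventually
  let φ := yMap C.θ (ModuleCat.of R R)
  let θ : (flip Cd.T)⟦(1 - n : ℤ)⟧ ⟶ (flip Cd.P)⟦(1 - n : ℤ)⟧ := (flipMap Cd.θ)⟦(1 - n : ℤ)⟧'
  have hU : HomExactInto (C.T.linearYonedaObj R (ModuleCat.of R R)) (ModuleCat.of R R) :=
    homExactInto_dual _ pCT fCT C.exactT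
  have hW : HomExactInto ((flip Cd.T)⟦(1 - n : ℤ)⟧) (ModuleCat.of R R) :=
    homExactInto_shift _ _ (homExactInto_flip _ _ Cd.exactTdual) _
  have hWT (X : CochainComplex (ModuleCat.{u} R) ℤ) (hX : HomExactInto X (ModuleCat.of R R)) (i) :
      HomExactInto X (((flip Cd.T)⟦(1 - n : ℤ)⟧).X i) := by
    have := pDT (-(i + (1 - n)))
    have := fDT (-(i + (1 - n)))
    exact homExactInto_of_ring X hX (Cd.T.X (-(i + (1 - n))))
  have hWP (X : CochainComplex (ModuleCat.{u} R) ℤ) (hX : HomExactInto X (ModuleCat.of R R)) (i) :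
      HomExactInto X (((flip Cd.P)⟦(1 - n : ℤ)⟧).X i) := by
    have := pDP (-(i + (1 - n)))
    have := fDP (-(i + (1 - n)))
    exact homExactInto_of_ring X hX (Cd.P.X (-(i + (1 - n))))
  have hflip (i : ℤ) (hi : i ≠ 0) : (flip Cd.P).ExactAt i := by
    obtain hi' | hi' := lt_or_gt_of_ne hi
    · rw [HomologicalComplex.exactAt_iff_isZero_homology]
      exact (Cd.exactP (-i) (by lia)).isZero_homology.of_iso (flipHomologyIso _ i (-i) rfl)
    · exact ShortComplex.exact_of_isZero_X₂ _ (Cd.zeroP (-i) (by lia))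
  obtain ⟨e1⟩ := homology_ext C (ModuleCat.of R R) n
  obtain ⟨e2⟩ := homology_P Cd
  obtain ⟨e⟩ : Nonempty ((qq _).obj (CochainComplex.mappingCone φ) ≅
      (qq _).obj ((flip Cd.P)⟦(1 - n : ℤ)⟧)) := by
    refine quotient_cone_iso φ C.exactTdual (n - 1)
      (fun i hi => linearYoneda_exactAt C _ n hM i (by lia))
      (fun i hi => shift_exactAt _ _ _ (hflip _ (by lia))) ?_ ?_ ?_ m1 ?_ (n - 1) ?_
    · exact eqToIso (by congr 1; lia) ≪≫ e1 ≪≫ e2.symm ≪≫ (flipHomologyIso _ 0 0 (by simp)).symm ≪≫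
        ((CochainComplex.ShiftSequence.shiftIso _ (1 - n : ℤ) (n - 1) 0 (by lia)).app _).symm
    · refine projective_cone φ ?_ ?_
      · intro i
        have : Module.Projective R ((C.P.linearYonedaObj R (ModuleCat.of R R)).X i) := inferInstance
        exact (IsProjective.iff_projective (R := R) _).1 this
      · intro i
        have : Module.Projective R ((C.T.linearYonedaObj R (ModuleCat.of R R)).X i) := inferInstance
        exact (IsProjective.iff_projective (R := R) _).1 this
    · intro i
      exact Cd.projP _
    · intro p hp
      have := hm1 p hp
      exact yMap_isIso _ _ _
    · intro p hp
      exact Cd.zeroP _ (by lia)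
  refine homotopyEquiv_of_cones φ θ e
    (fun i => homExactInto_of_ring _ hU _) (fun i => homExactInto_of_ring _ hW _)
    (homExactInto_cone _ θ (hWT _ hU) (hWP _ hU))
    (homExactInto_cone _ θ (hWT _ hW) (hWP _ hW)) 0 (linearYoneda_isZero C _)
    (n - 1 - m2) ?_
  intro p hp
  exact hm2 (-(p + (1 - n))) (by lia)

end PartK

end TateDual

namespace TateDual

section

variable {R}

/-- Homology of the image under an additive functor, transported along the homotopy equivalence. -/
def homologyIsoOfEquiv {A D : Type*} [Category* A] [Preadditive A] [HasZeroObject A]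
    [Category* D] [Abelian D]
    (F : A ⥤ D) [F.Additive] {U : CochainComplex A ℤ} {T : ChainComplex A ℤ} {a : ℤ}
    (h : HomotopyEquiv U ((flip T)⟦a⟧)) (i j : ℤ) (hj : j = -(a + i)) :
    ((F.mapHomologicalComplex (ComplexShape.up ℤ)).obj U).homology i ≅
      ((F.mapHomologicalComplex (ComplexShape.down ℤ)).obj T).homology j :=
  (F.mapHomotopyEquiv h).toHomologyIso i ≪≫
  (HomologicalComplex.homologyFunctor D (ComplexShape.up ℤ) i).mapIso
    (((F.mapHomologicalComplex (ComplexShape.up ℤ)).commShiftIso a).app (flip T)) ≪≫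
  (CochainComplex.ShiftSequence.shiftIso D a i (a + i) rfl).app
    ((F.mapHomologicalComplex (ComplexShape.up ℤ)).obj (flip T)) ≪≫
  flipHomologyIso ((F.mapHomologicalComplex (ComplexShape.down ℤ)).obj T) (a + i) j hj

/-- `Hom(T, R) ⊗ N ≅ Hom(T, N)` for finite projective `T`. -/
def dualTensorIso (T N : ModuleCat.{u} R) [Module.Finite R T] [Module.Projective R T] :
    ModuleCat.of R (T ⟶ ModuleCat.of R R) ⊗ N ≅ ModuleCat.of R (T ⟶ N) :=
  ((TensorProduct.congr (ModuleCat.homLinearEquiv (S := R)) (LinearEquiv.refl R N)) ≪≫ₗ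
    dualTensorHomEquiv R T N ≪≫ₗ (ModuleCat.homLinearEquiv (S := R)).symm).toModuleIso

lemma dualTensorIso_apply (T N : ModuleCat.{u} R) [Module.Finite R T] [Module.Projective R T]
    (f : T ⟶ ModuleCat.of R R) (x : N) (t : T) :
    ((dualTensorIso T N).hom.hom (f ⊗ₜ[R] x) : T ⟶ N).hom t = f.hom t • x := rfl

/-- `T ⊗ N ≅ Hom(Hom(T, R), N)` for finite projective `T`. -/
def bidualTensorIso (T N : ModuleCat.{u} R) [Module.Finite R T] [Module.Projective R T] :
    T ⊗ N ≅ ModuleCat.of R (ModuleCat.of R (T ⟶ ModuleCat.of R R) ⟶ N) :=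
  ((TensorProduct.congr (Module.evalEquiv R T) (LinearEquiv.refl R N)) ≪≫ₗ
    dualTensorHomEquiv R (Module.Dual R T) N ≪≫ₗ
    LinearEquiv.congrLeft N R (show Module.Dual R T ≃ₗ[R] ModuleCat.of R (T ⟶ ModuleCat.of R R) from
      (ModuleCat.homLinearEquiv (S := R) (M := T) (N := ModuleCat.of R R)).symm) ≪≫ₗ
      (ModuleCat.homLinearEquiv (S := R)).symm).toModuleIso

lemma bidualTensorIso_apply (T N : ModuleCat.{u} R) [Module.Finite R T] [Module.Projective R T]
    (f : T ⟶ ModuleCat.of R R) (x : N) (t : T) :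
    ((bidualTensorIso T N).hom.hom (t ⊗ₜ[R] x) :
      ModuleCat.of R (T ⟶ ModuleCat.of R R) ⟶ N).hom f = f.hom t • x := rfl

variable {M : ModuleCat.{u} R} (C : CompleteResolution R M) (N : ModuleCat.{u} R)

lemma finiteProj (i : ℤ) : Module.Finite R (C.T.X i) ∧ Module.Projective R (C.T.X i) :=
  ⟨C.fgT i, (IsProjective.iff_projective (R := R) _).2 (C.projT i)⟩

/-- `Hom(T, R) ⊗ N ≅ Hom(T, N)` for complexes. -/
def dualTensorComplexIso :
    (((tensoringRight (ModuleCat.{u} R)).obj N).mapHomologicalComplex (ComplexShape.up ℤ)).obj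
      (C.T.linearYonedaObj R (ModuleCat.of R R)) ≅ C.T.linearYonedaObj R N :=
  HomologicalComplex.Hom.isoOfComponents
    (fun i => haveI := (finiteProj C i).1; haveI := (finiteProj C i).2
      dualTensorIso (C.T.X i) N)
    (fun i j _ => by
      have := (finiteProj C i).1; have := (finiteProj C i).2
      have := (finiteProj C j).1; have := (finiteProj C j).2
      refine ModuleCat.MonoidalCategory.tensor_ext (fun f x => ?_)
      refine ModuleCat.hom_ext (LinearMap.ext fun t => ?_)
      rfl)

/-- `T ⊗ N ≅ Hom(Hom(T, R), N)` for complexes. -/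
def bidualTensorComplexIso :
    (((tensoringRight (ModuleCat.{u} R)).obj N).mapHomologicalComplex (ComplexShape.down ℤ)).obj
      C.T ≅ ((((linearYoneda R (ModuleCat.{u} R)).obj N).rightOp.mapHomologicalComplex
        (ComplexShape.up ℤ)).obj (C.T.linearYonedaObj R (ModuleCat.of R R))).unop :=
  HomologicalComplex.Hom.isoOfComponents
    (fun i => haveI := (finiteProj C i).1; haveI := (finiteProj C i).2
      bidualTensorIso (C.T.X i) N)
    (fun i j _ => by
      have := (finiteProj C i).1; have := (finiteProj C i).2
      have := (finiteProj C j).1; have := (finiteProj C j).2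
      refine ModuleCat.MonoidalCategory.tensor_ext (fun t x => ?_)
      refine ModuleCat.hom_ext (LinearMap.ext fun f => ?_)
      rfl)

variable {N}

/-- The second isomorphism. -/
lemma tateExt_iso_tateTor (n : ℕ) 
    (hM : ∀ i : ℕ, i ≠ n → IsZero (ExtMod R i M (ModuleCat.of R R)))
    (Cd : CompleteResolution R (ExtMod R n M (ModuleCat.of R R))) (i : ℤ) :
    Nonempty (TateExt R C N i ≅ TateTor R Cd N ((n : ℤ) - i - 1)) := by
  obtain ⟨h⟩ := main_homotopyEquiv n hM C Cd
  exact ⟨(HomologicalComplex.homologyFunctor _ _ i).mapIso (dualTensorComplexIso C N).symm ≪≫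
    homologyIsoOfEquiv ((tensoringRight (ModuleCat.{u} R)).obj N) h i _ (by ring)⟩

/-- The first isomorphism. -/
lemma tateExt_iso_tateTor' (n : ℕ) 
    (hM : ∀ i : ℕ, i ≠ n → IsZero (ExtMod R i M (ModuleCat.of R R)))
    (Cd : CompleteResolution R (ExtMod R n M (ModuleCat.of R R))) (i : ℤ) :
    Nonempty (TateExt R Cd N i ≅ TateTor R C N ((n : ℤ) - i - 1)) := by
  obtain ⟨h⟩ := main_homotopyEquiv n hM C Cd
  let F := ((linearYoneda R (ModuleCat.{u} R)).obj N).rightOp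
  let e := homologyIsoOfEquiv F h ((n : ℤ) - i - 1) i (by ring)
  let e1 : TateExt R Cd N i ≅
      unop (((F.mapHomologicalComplex (ComplexShape.down ℤ)).obj Cd.T).homology i) :=
    HomologicalComplex.homologyUnop _ i
  let e2 := HomologicalComplex.homologyUnop ((F.mapHomologicalComplex (ComplexShape.up ℤ)).obj
    (C.T.linearYonedaObj R (ModuleCat.of R R))) ((n : ℤ) - i - 1)
  let e3 : TateTor R C N ((n : ℤ) - i - 1) ≅ _ :=
    (HomologicalComplex.homologyFunctor _ _ ((n : ℤ) - i - 1)).mapIso (bidualTensorComplexIso C N)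
  exact ⟨e1 ≪≫ e.unop ≪≫ e2.symm ≪≫ e3.symm⟩

end

end TateDual

/-- Let `M` be a G-perfect module of Gorenstein dimension `n` over a (Noetherian) local
ring `R`, set `M† = Ext^n_R(M,R)`, and let `N` be a finitely generated `R`-module. Then
for all `i ∈ ℤ`: (i) `Êxt^i_R(M†,N) ≅ T̂or_{n-i-1}^R(M,N)`;
(ii) `Êxt^i_R(M,N) ≅ T̂or_{n-i-1}^R(M†,N)`. -/
theorem stmt_13 (R : Type) [CommRing R] [IsNoetherianRing R] [IsLocalRing R]
    (M : Type) [AddCommGroup M] [Module R M] [Module.Finite R M]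
    (n : ℕ) (hperf : IsGPerfect R (ModuleCat.of R M))
    (hn : gdim R (ModuleCat.of R M) = (n : ℕ∞))
    (N : Type) [AddCommGroup N] [Module R N] [Module.Finite R N]
    (Cd : CompleteResolution R (ExtMod R n (ModuleCat.of R M) (ModuleCat.of R R)))
    (C : CompleteResolution R (ModuleCat.of R M)) (i : ℤ) :
    Nonempty ((TateExt R Cd (ModuleCat.of R N) i) ≃ₗ[R]
      (TateTor R C (ModuleCat.of R N) ((n : ℤ) - i - 1))) ∧
    Nonempty ((TateExt R C (ModuleCat.of R N) i) ≃ₗ[R]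
      (TateTor R Cd (ModuleCat.of R N) ((n : ℤ) - i - 1))) := by
  have hM := TateDual.isZero_ext_of_perfect (ModuleCat.of R M) n hperf hn
  obtain ⟨e⟩ := TateDual.tateExt_iso_tateTor' (N := ModuleCat.of R N) C n hM Cd i
  obtain ⟨e'⟩ := TateDual.tateExt_iso_tateTor (N := ModuleCat.of R N) C n hM Cd i
  exact ⟨⟨e.toLinearEquiv⟩, ⟨e'.toLinearEquiv⟩⟩

end
end
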